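/- arXiv:2402.02792 — 7 statements merged into one kernel-verified Lean document; each statement's English description precedes it below -/
import Mathlib

section
/- Under the semi-discrete game setting, for every x ∈ ℝ^d the Elliott–Kalton semi-discrete value equals the Fleming alternating value: V_0(x) = V̄_0(x). -/
open MeasureTheory Set

noncomputable section

abbrev Euc (n : ℕ) : Type := EuclideanSpace ℝ (Fin n)

/-- periodic extension of a `Fin N`-tuple to an `ℕ`-indexed family -/
def extp {γ : Sort*} {N : ℕ} (hN : 0 < N) (c : Fin N → γ) : ℕ → γ :=
  fun k => c ⟨k % N, Nat.mod_lt k hN⟩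

/-- discrete trajectory driven by open-loop controls -/
def oTraj {d nA nB : ℕ} (F : Euc d → Euc nA → Euc nB → Euc d) (x : Euc d)
    (a : ℕ → Euc nA) (b : ℕ → Euc nB) : ℕ → Euc d
  | 0 => x
  | k + 1 => F (oTraj F x a b k) (a k) (b k)

/-- payoff `(max_{0 ≤ k ≤ N-1} g(x_k)) ⊔ φ(x_N)` -/
def payoff {d : ℕ} (g φ : Euc d → ℝ) (N : ℕ) (xs : ℕ → Euc d) : ℝ :=
  (⨆ k : Fin N, g (xs k)) ⊔ φ (xs N)

def J0 {d nA nB : ℕ} (F : Euc d → Euc nA → Euc nB → Euc d) (g φ : Euc d → ℝ)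
    {N : ℕ} (hN : 0 < N) (x : Euc d) (a : Fin N → Euc nA) (b : Fin N → Euc nB) : ℝ :=
  payoff g φ N (oTraj F x (extp hN a) (extp hN b))

/-- discrete non-anticipative strategies -/
def SN {nA nB : ℕ} (A : Set (Euc nA)) (B : Set (Euc nB)) (N : ℕ) : Type :=
  {α : (Fin N → B) → Fin N → A //
    Measurable α ∧ ∀ (k : Fin N) (b b' : Fin N → B), (∀ j ≤ k, b j = b' j) → α b k = α b' k}

/-- Elliott–Kalton semi-discrete value -/
def V0 {d nA nB : ℕ} (A : Set (Euc nA)) (B : Set (Euc nB))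
    (F : Euc d → Euc nA → Euc nB → Euc d) (g φ : Euc d → ℝ) {N : ℕ} (hN : 0 < N)
    (x : Euc d) : ℝ :=
  ⨅ α : SN A B N, ⨆ b : Fin N → B,
    J0 F g φ hN x (fun i => (α.1 b i : Euc nA)) (fun i => (b i : Euc nB))

/-- nested alternating sup-inf value -/
def altVal {α β : Type*} : (n : ℕ) → ((Fin n → α) → (Fin n → β) → ℝ) → ℝ
  | 0, J => J (fun i => i.elim0) (fun i => i.elim0)
  | n + 1, J => ⨆ b0 : β, ⨅ a0 : α, altVal n (fun a b => J (Fin.cons a0 a) (Fin.cons b0 b))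

/-- Fleming alternating value -/
def flemingV0 {d nA nB : ℕ} (A : Set (Euc nA)) (B : Set (Euc nB))
    (F : Euc d → Euc nA → Euc nB → Euc d) (g φ : Euc d → ℝ) {N : ℕ} (hN : 0 < N)
    (x : Euc d) : ℝ :=
  altVal N (fun (a : Fin N → A) (b : Fin N → B) =>
    J0 F g φ hN x (fun i => (a i : Euc nA)) (fun i => (b i : Euc nB)))

/-- feedback trajectory -/
def fbTraj {d nA nB : ℕ} {A : Set (Euc nA)} {B : Set (Euc nB)}
    (F : Euc d → Euc nA → Euc nB → Euc d) (x : Euc d)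
    (α : ℕ → Euc d × B → A) (b : ℕ → Euc d → B) : ℕ → Euc d
  | 0 => x
  | k + 1 =>
    F (fbTraj F x α b k)
      (α k (fbTraj F x α b k, b k (fbTraj F x α b k)) : Euc nA)
      (b k (fbTraj F x α b k) : Euc nB)

/-- set of measurable feedback strategies `ℝ^d × B → A` -/
def Gm (d : ℕ) {nA nB : ℕ} (A : Set (Euc nA)) (B : Set (Euc nB)) : Type :=
  {α : Euc d × B → A // Measurable α}

/-- set of measurable feedback controls `ℝ^d → B` -/
def Bm (d : ℕ) {nB : ℕ} (B : Set (Euc nB)) : Type :=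
  {b : Euc d → B // Measurable b}

def Am (d : ℕ) {nA : ℕ} (A : Set (Euc nA)) : Type :=
  {a : Euc d → A // Measurable a}

/-- payoff `J̃0` for a feedback strategy against an open-loop control -/
def tJ0 {d nA nB : ℕ} {A : Set (Euc nA)} {B : Set (Euc nB)}
    (F : Euc d → Euc nA → Euc nB → Euc d) (g φ : Euc d → ℝ) {N : ℕ} (hN : 0 < N)
    (x : Euc d) (α : Fin N → Euc d × B → A) (b : Fin N → B) : ℝ :=
  payoff g φ N (fbTraj F x (extp hN α) (fun k _ => extp hN b k))

/-- payoff `J̃0` for a feedback strategy against a feedback control -/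
def tJ0fb {d nA nB : ℕ} {A : Set (Euc nA)} {B : Set (Euc nB)}
    (F : Euc d → Euc nA → Euc nB → Euc d) (g φ : Euc d → ℝ) {N : ℕ} (hN : 0 < N)
    (x : Euc d) (α : Fin N → Euc d × B → A) (b : Fin N → Euc d → B) : ℝ :=
  payoff g φ N (fbTraj F x (extp hN α) (extp hN b))

/-- feedback value `Ṽ0` -/
def tV0 {d nA nB : ℕ} (A : Set (Euc nA)) (B : Set (Euc nB))
    (F : Euc d → Euc nA → Euc nB → Euc d) (g φ : Euc d → ℝ) {N : ℕ} (hN : 0 < N)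
    (x : Euc d) : ℝ :=
  ⨅ α : Fin N → Gm d A B, ⨆ b : Fin N → B,
    tJ0 F g φ hN x (fun k => (α k).1) b

/-- intermediate value functions (backward DPP); `Vk m` is the value with `m` steps to go. -/
def Vdpp {d nA nB : ℕ} (A : Set (Euc nA)) (B : Set (Euc nB))
    (F : Euc d → Euc nA → Euc nB → Euc d) (g φ : Euc d → ℝ) : ℕ → Euc d → ℝ
  | 0, x => φ x
  | m + 1, x => ⨆ b : B, ⨅ a : A, g x ⊔ Vdpp A B F g φ m (F x (a : Euc nA) (b : Euc nB))


/-- A map between sequences is nonanticipative if its `k`-th output depends only on the inputs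
up to time `k`. -/
def IsNonanticipative {α β : Type*} {n : ℕ} (σ : (Fin n → β) → Fin n → α) : Prop :=
  ∀ (k : Fin n) (b b' : Fin n → β), (∀ j ≤ k, b j = b' j) → σ b k = σ b' k

lemma altVal_mem_Icc {α β : Type*} [Nonempty α] [Nonempty β] {C : ℝ} (n : ℕ)
    (J : (Fin n → α) → (Fin n → β) → ℝ) (hJ : ∀ a b, J a b ∈ Icc (-C) C) :
    altVal n J ∈ Icc (-C) C := by
  induction n with
  | zero => exact hJ _ _
  | succ n ih =>
    have h : ∀ (b0 : β) (a0 : α),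
        altVal n (fun a b => J (Fin.cons a0 a) (Fin.cons b0 b)) ∈ Icc (-C) C :=
      fun b0 a0 => ih _ fun a b => hJ _ _
    have h' : ∀ b0 : β,
        (⨅ a0 : α, altVal n (fun a b => J (Fin.cons a0 a) (Fin.cons b0 b))) ∈ Icc (-C) C :=
      fun b0 => ⟨le_ciInf fun a0 => (h b0 a0).1,
        (ciInf_le ⟨-C, by rintro _ ⟨a0, rfl⟩; exact (h b0 a0).1⟩ (Classical.arbitrary α)).trans
          (h b0 _).2⟩
    exact ⟨(h' (Classical.arbitrary β)).1.trans
      (le_ciSup (f := fun b0 : β =>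
        ⨅ a0 : α, altVal n (fun a b => J (Fin.cons a0 a) (Fin.cons b0 b)))
        ⟨C, by rintro _ ⟨b0, rfl⟩; exact (h' b0).2⟩ _), ciSup_le fun b0 => (h' b0).2⟩

lemma altVal_le_of_isNonanticipative {α β : Type*} [Nonempty α] [Nonempty β] {C c : ℝ} (n : ℕ)
    (J : (Fin n → α) → (Fin n → β) → ℝ) (hJ : ∀ a b, J a b ∈ Icc (-C) C)
    (σ : (Fin n → β) → Fin n → α) (hσ : IsNonanticipative σ) (hc : ∀ b, J (σ b) b ≤ c) :
    altVal n J ≤ c := by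
  induction n with
  | zero =>
    refine le_of_eq_of_le ?_ (hc fun i => i.elim0)
    exact congrArg (fun a => J a fun i => i.elim0) (Subsingleton.elim _ _)
  | succ n ih =>
    refine ciSup_le fun b0 => ?_
    let a0 : α := σ (fun _ => b0) 0
    have hσ0 : ∀ b : Fin n → β, σ (Fin.cons b0 b) 0 = a0 := fun b => by
      refine hσ 0 _ _ fun j hj => ?_
      obtain rfl : j = 0 := by simpa using hj
      simp
    refine (ciInf_le ⟨-C, ?_⟩ a0).trans ?_
    · rintro _ ⟨a, rfl⟩
      exact (altVal_mem_Icc n _ fun _ _ => hJ _ _).1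
    · refine ih _ (fun _ _ => hJ _ _) (fun b => Fin.tail (σ (Fin.cons b0 b))) ?_ fun b => ?_
      · intro k b b' h
        refine hσ k.succ _ _ fun j hj => ?_
        cases j using Fin.cases with
        | zero => simp
        | succ j => simpa using h j (Fin.succ_le_succ_iff.1 hj)
      · rw [← hσ0 b, Fin.cons_self_tail]
        exact hc _

lemma exists_isNonanticipative_of_altVal_lt {α β : Type*} [Nonempty α] [Nonempty β] {C c : ℝ}
    (n : ℕ) (J : (Fin n → α) → (Fin n → β) → ℝ) (hJ : ∀ a b, J a b ∈ Icc (-C) C)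
    (hc : altVal n J < c) :
    ∃ σ : (Fin n → β) → Fin n → α, IsNonanticipative σ ∧ ∀ b, J (σ b) b ≤ c := by
  induction n with
  | zero =>
    refine ⟨fun _ i => i.elim0, fun k => k.elim0, fun b => ?_⟩
    rw [Subsingleton.elim b fun i => i.elim0]
    exact hc.le
  | succ n ih =>
    have hmem : ∀ (b0 : β) (a0 : α),
        altVal n (fun a b => J (Fin.cons a0 a) (Fin.cons b0 b)) ∈ Icc (-C) C :=
      fun b0 a0 => altVal_mem_Icc n _ fun _ _ => hJ _ _
    have hlt : ∀ b0 : β, ∃ a0 : α,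
        altVal n (fun a b => J (Fin.cons a0 a) (Fin.cons b0 b)) < c := fun b0 => by
      refine exists_lt_of_ciInf_lt (lt_of_le_of_lt ?_ hc)
      refine le_ciSup (f := fun b0 : β =>
        ⨅ a0 : α, altVal n (fun a b => J (Fin.cons a0 a) (Fin.cons b0 b))) ⟨C, ?_⟩ b0
      rintro _ ⟨b, rfl⟩
      exact (ciInf_le ⟨-C, by rintro _ ⟨a, rfl⟩; exact (hmem b a).1⟩
        (Classical.arbitrary α)).trans (hmem b _).2
    choose a0 ha0 using hlt
    choose σ hσ hσc using fun b0 => ih _ (fun _ _ => hJ _ _) (ha0 b0)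
    refine ⟨fun b => Fin.cons (a0 (b 0)) (σ (b 0) (Fin.tail b)), ?_, fun b => ?_⟩
    · intro k b b' h
      have h0 : b 0 = b' 0 := h 0 (Fin.zero_le k)
      cases k using Fin.cases with
      | zero => simp [h0]
      | succ k =>
        simp only [Fin.cons_succ, h0]
        exact hσ _ k _ _ fun j hj => h j.succ (Fin.succ_le_succ_iff.2 hj)
    · simpa using hσc (b 0) (Fin.tail b)

lemma exists_measurable_nat_dist_lt (β : Type*) [PseudoMetricSpace β]
    [TopologicalSpace.SeparableSpace β] [Nonempty β] [MeasurableSpace β] [OpensMeasurableSpace β]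
    {δ : ℝ} (hδ : 0 < δ) :
    ∃ (e : ℕ → β) (f : β → ℕ), Measurable f ∧ ∀ b, dist b (e (f b)) < δ := by
  classical
  let e := TopologicalSpace.denseSeq β
  have hex : ∀ b, ∃ m, dist b (e m) < δ := fun b => by
    obtain ⟨m, hm⟩ := (TopologicalSpace.denseRange_denseSeq β).exists_dist_lt b hδ
    exact ⟨m, hm⟩
  exact ⟨e, fun b => Nat.find (hex b), measurable_find hex fun m =>
    measurableSet_ball (x := e m) (ε := δ), fun b => Nat.find_spec (hex b)⟩

lemma exists_measurable_isNonanticipative_of_altVal_lt {α β : Type*}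
    [PseudoMetricSpace α] [CompactSpace α] [Nonempty α] [MeasurableSpace α]
    [PseudoMetricSpace β] [CompactSpace β] [Nonempty β] [MeasurableSpace β]
    [OpensMeasurableSpace β] {C c : ℝ} (n : ℕ) (J : (Fin n → α) → (Fin n → β) → ℝ)
    (hJc : Continuous fun p : (Fin n → α) × (Fin n → β) => J p.1 p.2)
    (hJ : ∀ a b, J a b ∈ Icc (-C) C) (hc : altVal n J < c) :
    ∃ σ : (Fin n → β) → Fin n → α,
      Measurable σ ∧ IsNonanticipative σ ∧ ∀ b, J (σ b) b ≤ c := by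
  obtain ⟨c', hc', hcc'⟩ := exists_between hc
  obtain ⟨σ, hσ, hσc⟩ := exists_isNonanticipative_of_altVal_lt n J hJ hc'
  obtain ⟨δ, hδ, hJδ⟩ := Metric.uniformContinuous_iff.1
    (CompactSpace.uniformContinuous_of_continuous hJc) (c - c') (sub_pos.2 hcc')
  obtain ⟨e, f, hf, hef⟩ := exists_measurable_nat_dist_lt β hδ
  refine ⟨fun b => σ fun i => e (f (b i)), ?_, ?_, fun b => ?_⟩
  · exact (Measurable.of_discrete (f := fun m : Fin n → ℕ => σ fun i => e (m i))).comp
      (measurable_pi_lambda _ fun i => hf.comp (measurable_pi_apply i))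
  · exact fun k b b' h => hσ k _ _ fun j hj => by rw [h j hj]
  · have hd :
        dist (σ fun i => e (f (b i)), b) (σ fun i => e (f (b i)), fun i => e (f (b i))) < δ := by
      rw [Prod.dist_eq, dist_self, max_lt_iff]
      exact ⟨hδ, (dist_pi_lt_iff hδ).2 fun i => hef (b i)⟩
    have h := hJδ hd
    rw [Real.dist_eq] at h
    have h1 := (abs_lt.1 h).2
    have h2 := hσc fun i => e (f (b i))
    dsimp only at h1
    linarith

lemma continuous_oTraj {d nA nB : ℕ} {T : Type*} [TopologicalSpace T]
    {F : Euc d → Euc nA → Euc nB → Euc d}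
    (hF : Continuous fun p : Euc d × Euc nA × Euc nB => F p.1 p.2.1 p.2.2) (x : Euc d)
    {a : T → ℕ → Euc nA} {b : T → ℕ → Euc nB} (ha : ∀ k, Continuous fun t => a t k)
    (hb : ∀ k, Continuous fun t => b t k) (k : ℕ) :
    Continuous fun t => oTraj F x (a t) (b t) k := by
  induction k with
  | zero => exact continuous_const
  | succ k ih => exact hF.comp (ih.prodMk ((ha k).prodMk (hb k)))

lemma continuous_payoff {d N : ℕ} (hN : 0 < N) {T : Type*} [TopologicalSpace T]
    {g φ : Euc d → ℝ} (hg : Continuous g) (hφ : Continuous φ) {X : T → ℕ → Euc d}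
    (hX : ∀ k, Continuous fun t => X t k) : Continuous fun t => payoff g φ N (X t) := by
  have : Nonempty (Fin N) := ⟨⟨0, hN⟩⟩
  simp only [payoff, ← Finset.sup'_univ_eq_ciSup]
  exact (Continuous.finset_sup'_apply (f := fun (k : Fin N) t => g (X t k)) _
    fun k _ => hg.comp (hX k)).sup (hφ.comp (hX N))

theorem elliott_kalton_eq_fleming {d nA nB : ℕ} (hnA : 1 ≤ nA) (hnB : 1 ≤ nB)
    (A : Set (Euc nA)) (B : Set (Euc nB))
    (hAne : A.Nonempty) (hAc : IsCompact A) (hBne : B.Nonempty) (hBc : IsCompact B)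
    (F : Euc d → Euc nA → Euc nB → Euc d)
    (hF : Continuous fun p : Euc d × Euc nA × Euc nB => F p.1 p.2.1 p.2.2)
    (g φ : Euc d → ℝ) (Kg Kφ : NNReal) (hg : LipschitzWith Kg g) (hφ : LipschitzWith Kφ φ)
    (N : ℕ) (hN : 0 < N) (x : Euc d) :
    V0 A B F g φ hN x = flemingV0 A B F g φ hN x := by
  have : Nonempty A := hAne.to_subtype
  have : Nonempty B := hBne.to_subtype
  have : CompactSpace A := isCompact_iff_compactSpace.1 hAc
  have : CompactSpace B := isCompact_iff_compactSpace.1 hBc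
  let J : (Fin N → A) → (Fin N → B) → ℝ := fun a b =>
    J0 F g φ hN x (fun i => (a i : Euc nA)) (fun i => (b i : Euc nB))
  have hJc : Continuous fun p : (Fin N → A) × (Fin N → B) => J p.1 p.2 := by
    refine continuous_payoff hN hg.continuous hφ.continuous
      (continuous_oTraj hF x (fun k => ?_) fun k => ?_) <;>
    · simp only [extp]
      fun_prop
  obtain ⟨C, hC⟩ := isCompact_univ.exists_bound_of_continuousOn hJc.continuousOn
  have hJ : ∀ a b, J a b ∈ Icc (-C) C := fun a b => abs_le.1 (hC (a, b) (mem_univ _))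
  have hbdd : ∀ α : SN A B N, BddAbove (range fun b => J (α.1 b) b) :=
    fun α => ⟨C, by rintro _ ⟨b, rfl⟩; exact (hJ _ _).2⟩
  have : Nonempty (SN A B N) :=
    ⟨⟨fun _ _ => Classical.arbitrary A, measurable_const, fun _ _ _ _ => rfl⟩⟩
  change ⨅ α : SN A B N, ⨆ b : Fin N → B, J (α.1 b) b = altVal N J
  refine le_antisymm (le_of_forall_gt_imp_ge_of_dense fun c hc => ?_) (le_ciInf fun α => ?_)
  · obtain ⟨σ, hσm, hσ, hσc⟩ :=
      exists_measurable_isNonanticipative_of_altVal_lt N J hJc hJ hc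
    refine (ciInf_le ⟨-C, ?_⟩ (⟨σ, hσm, hσ⟩ : SN A B N)).trans (ciSup_le hσc)
    rintro _ ⟨α, rfl⟩
    exact (hJ _ _).1.trans (le_ciSup (hbdd α) (Classical.arbitrary _))
  · exact altVal_le_of_isNonanticipative N J hJ α.1 α.2.2 (le_ciSup (hbdd α))

end
end

section
/- Under the semi-discrete game setting, for every x ∈ ℝ^d the feedback-strategy value equals the Fleming alternating value: Ṽ_0(x) = V̄_0(x). -/
open MeasureTheory Set

noncomputable section

section ParametricExtrema

variable {X K : Type*} [TopologicalSpace X] [TopologicalSpace K] [CompactSpace K]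

theorem continuous_iSup_of_compactSpace {f : X → K → ℝ}
    (hf : Continuous fun p : X × K => f p.1 p.2) : Continuous fun x => ⨆ k, f x k := by
  have h := (isCompact_univ (X := K)).continuous_sSup (f := f) hf
  simpa only [image_univ, sSup_range] using h

theorem continuous_iInf_of_compactSpace {f : X → K → ℝ}
    (hf : Continuous fun p : X × K => f p.1 p.2) : Continuous fun x => ⨅ k, f x k := by
  have h := (isCompact_univ (X := K)).continuous_sInf (f := f) hf
  simpa only [image_univ, sInf_range] using h

theorem bddAbove_range_of_compactSpace {f : K → ℝ} (hf : Continuous f) :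
    BddAbove (range f) :=
  (isCompact_range hf).bddAbove

theorem bddBelow_range_of_compactSpace {f : K → ℝ} (hf : Continuous f) :
    BddBelow (range f) :=
  (isCompact_range hf).bddBelow

theorem exists_eq_ciSup_of_compactSpace [Nonempty K] {f : K → ℝ} (hf : Continuous f) :
    ∃ k, f k = ⨆ j, f j :=
  (isCompact_range hf).sSup_mem (range_nonempty f)

theorem exists_measurable_le_iInf_add [Nonempty K] [TopologicalSpace.SeparableSpace K]
    [MeasurableSpace X] [OpensMeasurableSpace X] [MeasurableSpace K]
    {f : X → K → ℝ} (hf : Continuous fun p : X × K => f p.1 p.2) {ε : ℝ} (hε : 0 < ε) :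
    ∃ s : X → K, Measurable s ∧ ∀ x, f x (s x) ≤ (⨅ k, f x k) + ε := by
  classical
  have hinf := continuous_iInf_of_compactSpace hf
  have hex : ∀ x, ∃ n, f x (TopologicalSpace.denseSeq K n) < (⨅ k, f x k) + ε := by
    intro x
    obtain ⟨k, hk⟩ := exists_lt_of_ciInf_lt (lt_add_of_pos_right (⨅ k, f x k) hε)
    have hopen : IsOpen {k | f x k < (⨅ k, f x k) + ε} :=
      isOpen_lt (by fun_prop) continuous_const
    exact (TopologicalSpace.denseRange_denseSeq K).exists_mem_open hopen ⟨k, hk⟩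
  refine ⟨fun x => TopologicalSpace.denseSeq K (Nat.find (hex x)),
    measurable_from_nat.comp (measurable_find hex fun n => ?_),
    fun x => (Nat.find_spec (hex x)).le⟩
  exact (isOpen_lt (by fun_prop) (hinf.add continuous_const)).measurableSet

end ParametricExtrema

theorem extp_coe {γ : Sort*} {N : ℕ} (hN : 0 < N) (c : Fin N → γ) (i : Fin N) :
    extp hN c i = c i := by
  simp [extp, Nat.mod_eq_of_lt i.2]

/-- The payoff with `n` steps to go, by recursion on `n`. -/
def runningPayoff {d : ℕ} (g φ : Euc d → ℝ) : ℕ → (ℕ → Euc d) → ℝ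
  | 0, xs => φ (xs 0)
  | n + 1, xs => g (xs 0) ⊔ runningPayoff g φ n (fun k => xs (k + 1))

theorem runningPayoff_le_iff {d : ℕ} (g φ : Euc d → ℝ) (c : ℝ) (n : ℕ) (xs : ℕ → Euc d) :
    runningPayoff g φ n xs ≤ c ↔ (∀ k : Fin n, g (xs k) ≤ c) ∧ φ (xs n) ≤ c := by
  induction n generalizing xs with
  | zero => simp [runningPayoff]
  | succ n ih => simp [runningPayoff, ih, Fin.forall_fin_succ, and_assoc]

theorem payoff_eq_runningPayoff {d : ℕ} (g φ : Euc d → ℝ) {N : ℕ} (hN : 0 < N)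
    (xs : ℕ → Euc d) : payoff g φ N xs = runningPayoff g φ N xs := by
  have : Nonempty (Fin N) := ⟨⟨0, hN⟩⟩
  refine eq_of_forall_ge_iff fun c => ?_
  rw [runningPayoff_le_iff, payoff, sup_le_iff, ciSup_le_iff (Set.finite_range _).bddAbove]

theorem oTraj_succ {d nA nB : ℕ} (F : Euc d → Euc nA → Euc nB → Euc d) (x : Euc d)
    (a : ℕ → Euc nA) (b : ℕ → Euc nB) (k : ℕ) :
    oTraj F x a b (k + 1) =
      oTraj F (F x (a 0) (b 0)) (fun j => a (j + 1)) (fun j => b (j + 1)) k := by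
  induction k with
  | zero => rfl
  | succ k ih => rw [oTraj, ih, oTraj]

section Game

variable {d nA nB : ℕ} {A : Set (Euc nA)} {B : Set (Euc nB)}
  {F : Euc d → Euc nA → Euc nB → Euc d} {g φ : Euc d → ℝ}

theorem runningPayoff_oTraj_succ (x : Euc d) (a : ℕ → Euc nA) (b : ℕ → Euc nB) (n : ℕ) :
    runningPayoff g φ (n + 1) (oTraj F x a b) =
      g x ⊔ runningPayoff g φ n
        (oTraj F (F x (a 0) (b 0)) (fun j => a (j + 1)) (fun j => b (j + 1))) := by
  simp only [runningPayoff, oTraj_succ]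
  rfl

theorem fbTraj_succ (x : Euc d) (α : ℕ → Euc d × B → A) (b : ℕ → B) (k : ℕ) :
    fbTraj F x α (fun j _ => b j) (k + 1) =
      fbTraj F (F x (α 0 (x, b 0)) (b 0)) (fun j => α (j + 1)) (fun j _ => b (j + 1)) k := by
  induction k with
  | zero => rfl
  | succ k ih => rw [fbTraj, ih, fbTraj]

theorem runningPayoff_fbTraj_succ (x : Euc d) (α : ℕ → Euc d × B → A) (b : ℕ → B) (n : ℕ) :
    runningPayoff g φ (n + 1) (fbTraj F x α fun j _ => b j) =
      g x ⊔ runningPayoff g φ n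
        (fbTraj F (F x (α 0 (x, b 0)) (b 0)) (fun j => α (j + 1)) fun j _ => b (j + 1)) := by
  simp only [runningPayoff, fbTraj_succ]
  rfl

theorem continuous_stage {V : Euc d → ℝ} (hV : Continuous V)
    (hF : Continuous fun p : Euc d × Euc nA × Euc nB => F p.1 p.2.1 p.2.2)
    (hg : Continuous g) :
    Continuous fun p : (Euc d × B) × A => g p.1.1 ⊔ V (F p.1.1 p.2 p.1.2) := by
  have h : Continuous fun p : (Euc d × B) × A => F p.1.1 p.2 p.1.2 :=
    hF.comp (g := fun p : Euc d × Euc nA × Euc nB => F p.1 p.2.1 p.2.2)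
      (f := fun p : (Euc d × B) × A => (p.1.1, (p.2 : Euc nA), (p.1.2 : Euc nB))) (by fun_prop)
  fun_prop

theorem runningPayoff_fbTraj_le_Vdpp_add {ε : ℝ} (hε : 0 ≤ ε) (n : ℕ) (x : Euc d)
    (α : ℕ → Euc d × B → A) (v : ℕ → B)
    (hα : ∀ k m, m + k + 1 = n → ∀ y b,
      g y ⊔ Vdpp A B F g φ m (F y (α k (y, b)) b) ≤ Vdpp A B F g φ (m + 1) y + ε) :
    runningPayoff g φ n (fbTraj F x α fun k _ => v k) ≤ Vdpp A B F g φ n x + n * ε := by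
  induction n generalizing x α v with
  | zero => simp [runningPayoff, Vdpp, fbTraj]
  | succ n ih =>
    rw [runningPayoff_fbTraj_succ]
    have hnext := ih (F x (α 0 (x, v 0)) (v 0)) (fun j => α (j + 1)) (fun j => v (j + 1))
      fun k m hkm => hα (k + 1) m (by omega)
    have hfirst := sup_le_iff.1 (hα 0 n rfl x (v 0))
    have hnε : 0 ≤ (n : ℝ) * ε := by positivity
    push_cast
    refine sup_le ?_ ?_ <;> linarith [hfirst.1, hfirst.2]

variable [CompactSpace A]

theorem bddBelow_range_stage {V : Euc d → ℝ} (hV : Continuous V)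
    (hF : Continuous fun p : Euc d × Euc nA × Euc nB => F p.1 p.2.1 p.2.2)
    (hg : Continuous g) (x : Euc d) (b : B) :
    BddBelow (range fun a : A => g x ⊔ V (F x a b)) :=
  bddBelow_range_of_compactSpace
    ((continuous_stage hV hF hg).comp (Continuous.prodMk_right (x, b)))

theorem continuous_iInf_stage {V : Euc d → ℝ} (hV : Continuous V)
    (hF : Continuous fun p : Euc d × Euc nA × Euc nB => F p.1 p.2.1 p.2.2)
    (hg : Continuous g) :
    Continuous fun p : Euc d × B => ⨅ a : A, g p.1 ⊔ V (F p.1 a p.2) :=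
  continuous_iInf_of_compactSpace
    (f := fun (p : Euc d × B) (a : A) => g p.1 ⊔ V (F p.1 a p.2)) (continuous_stage hV hF hg)

variable [CompactSpace B]

theorem bddAbove_range_iInf_stage {V : Euc d → ℝ} (hV : Continuous V)
    (hF : Continuous fun p : Euc d × Euc nA × Euc nB => F p.1 p.2.1 p.2.2)
    (hg : Continuous g) (x : Euc d) :
    BddAbove (range fun b : B => ⨅ a : A, g x ⊔ V (F x a b)) :=
  bddAbove_range_of_compactSpace
    ((continuous_iInf_stage hV hF hg).comp (Continuous.prodMk_right x))

theorem continuous_Vdpp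
    (hF : Continuous fun p : Euc d × Euc nA × Euc nB => F p.1 p.2.1 p.2.2)
    (hg : Continuous g) (hφ : Continuous φ) (n : ℕ) : Continuous (Vdpp A B F g φ n) := by
  induction n with
  | zero => exact hφ
  | succ n ih =>
    exact continuous_iSup_of_compactSpace (continuous_iInf_stage ih hF hg)

theorem exists_runningPayoff_fbTraj_le
    (hF : Continuous fun p : Euc d × Euc nA × Euc nB => F p.1 p.2.1 p.2.2)
    (hg : Continuous g) (hφ : Continuous φ) (n : ℕ) {K : Set (Euc d)} (hK : IsCompact K) :
    ∃ C, ∀ x ∈ K, ∀ (α : ℕ → Euc d × B → A) (v : ℕ → B),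
      runningPayoff g φ n (fbTraj F x α fun k _ => v k) ≤ C := by
  induction n generalizing K with
  | zero =>
    obtain ⟨C, hC⟩ := hK.bddAbove_image hφ.continuousOn
    exact ⟨C, fun x hx α v => hC (mem_image_of_mem φ hx)⟩
  | succ n ih =>
    obtain ⟨C, hC⟩ := hK.bddAbove_image hg.continuousOn
    have hA : IsCompact A := isCompact_iff_compactSpace.2 inferInstance
    have hB : IsCompact B := isCompact_iff_compactSpace.2 inferInstance
    obtain ⟨C', hC'⟩ := ih ((hK.prod (hA.prod hB)).image hF)
    refine ⟨C ⊔ C', fun x hx α v => ?_⟩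
    rw [runningPayoff_fbTraj_succ]
    refine sup_le_sup (hC (mem_image_of_mem g hx)) (hC' _ ?_ _ _)
    exact ⟨(x, (α 0 (x, v 0) : Euc nA), (v 0 : Euc nB)),
      ⟨hx, (α 0 (x, v 0)).2, (v 0).2⟩, rfl⟩

theorem exists_Vdpp_le_runningPayoff [Nonempty B]
    (hF : Continuous fun p : Euc d × Euc nA × Euc nB => F p.1 p.2.1 p.2.2)
    (hg : Continuous g) (hφ : Continuous φ) (n : ℕ) (x : Euc d) (α : ℕ → Euc d × B → A) :
    ∃ b : Fin n → B, ∀ v : ℕ → B, (∀ i : Fin n, v i = b i) →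
      Vdpp A B F g φ n x ≤ runningPayoff g φ n (fbTraj F x α fun k _ => v k) := by
  induction n generalizing x α with
  | zero => exact ⟨fun i => i.elim0, fun v _ => le_rfl⟩
  | succ n ih =>
    obtain ⟨b₀, hb₀⟩ := exists_eq_ciSup_of_compactSpace
      ((continuous_iInf_stage (A := A) (B := B)
        (continuous_Vdpp (A := A) (B := B) hF hg hφ n) hF hg).comp (Continuous.prodMk_right x))
    obtain ⟨b, hb⟩ := ih (F x (α 0 (x, b₀)) b₀) fun j => α (j + 1)
    refine ⟨Fin.cons b₀ b, fun v hv => ?_⟩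
    have hv0 : v 0 = b₀ := by simpa using hv 0
    rw [runningPayoff_fbTraj_succ, hv0]
    refine (le_of_eq hb₀.symm).trans ?_
    refine (ciInf_le
      (bddBelow_range_stage (continuous_Vdpp (A := A) (B := B) hF hg hφ n) hF hg x b₀)
      (α 0 (x, b₀))).trans ?_
    exact sup_le_sup_left (hb (fun j => v (j + 1)) fun i => by simpa using hv i.succ) _

variable [Nonempty A]

theorem exists_measurable_stage_le
    (hF : Continuous fun p : Euc d × Euc nA × Euc nB => F p.1 p.2.1 p.2.2)
    (hg : Continuous g) (hφ : Continuous φ) {ε : ℝ} (hε : 0 < ε) (n : ℕ) :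
    ∃ s : Euc d × B → A, Measurable s ∧ ∀ x b,
      g x ⊔ Vdpp A B F g φ n (F x (s (x, b)) b) ≤ Vdpp A B F g φ (n + 1) x + ε := by
  have hstage := continuous_stage (A := A) (B := B)
    (continuous_Vdpp (A := A) (B := B) hF hg hφ n) hF hg
  obtain ⟨s, hs, hle⟩ := exists_measurable_le_iInf_add
    (f := fun (p : Euc d × B) (a : A) => g p.1 ⊔ Vdpp A B F g φ n (F p.1 a p.2)) hstage hε
  refine ⟨s, hs, fun x b => (hle (x, b)).trans (add_le_add_left ?_ ε)⟩
  exact le_ciSup (f := fun b : B => ⨅ a : A, g x ⊔ Vdpp A B F g φ n (F x a b))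
    (bddAbove_range_iInf_stage (continuous_Vdpp hF hg hφ n) hF hg x) b

variable [Nonempty B]

theorem altVal_eq_sup_Vdpp
    (hF : Continuous fun p : Euc d × Euc nA × Euc nB => F p.1 p.2.1 p.2.2)
    (hg : Continuous g) (hφ : Continuous φ) (n : ℕ) (c : ℝ) (x : Euc d)
    (J : (Fin n → A) → (Fin n → B) → ℝ)
    (hJ : ∀ a b, ∃ (u : ℕ → Euc nA) (v : ℕ → Euc nB),
      (∀ i : Fin n, u i = a i) ∧ (∀ i : Fin n, v i = b i) ∧
        J a b = c ⊔ runningPayoff g φ n (oTraj F x u v)) :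
    altVal n J = c ⊔ Vdpp A B F g φ n x := by
  induction n generalizing c x with
  | zero =>
    obtain ⟨u, v, -, -, h⟩ := hJ (fun i => i.elim0) (fun i => i.elim0)
    exact h
  | succ n ih =>
    have hstep : ∀ (b : B) (a : A),
        altVal n (fun a' b' => J (Fin.cons a a') (Fin.cons b b')) =
          c ⊔ (g x ⊔ Vdpp A B F g φ n (F x a b)) := by
      intro b a
      rw [← sup_assoc]
      refine ih (c ⊔ g x) (F x a b) _ fun a' b' => ?_
      obtain ⟨u, v, hu, hv, h⟩ := hJ (Fin.cons a a') (Fin.cons b b')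
      refine ⟨fun j => u (j + 1), fun j => v (j + 1), fun i => by simpa using hu i.succ,
        fun i => by simpa using hv i.succ, ?_⟩
      have hu0 : u 0 = a := by simpa using hu 0
      have hv0 : v 0 = b := by simpa using hv 0
      rw [h, runningPayoff_oTraj_succ, hu0, hv0, sup_assoc]
    have hmono : Monotone fun t : ℝ => c ⊔ t := fun s t hst => sup_le_sup_left hst c
    have hcont : Continuous fun t : ℝ => c ⊔ t := by fun_prop
    simp only [altVal, hstep, Vdpp]
    rw [hmono.map_ciSup_of_continuousAt hcont.continuousAt
      (bddAbove_range_iInf_stage (continuous_Vdpp hF hg hφ n) hF hg x)]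
    refine iSup_congr fun b => ?_
    rw [hmono.map_ciInf_of_continuousAt hcont.continuousAt
      (bddBelow_range_stage (continuous_Vdpp hF hg hφ n) hF hg x b)]

theorem flemingV0_eq_Vdpp
    (hF : Continuous fun p : Euc d × Euc nA × Euc nB => F p.1 p.2.1 p.2.2)
    (hg : Continuous g) (hφ : Continuous φ) {N : ℕ} (hN : 0 < N) (x : Euc d) :
    flemingV0 A B F g φ hN x = Vdpp A B F g φ N x := by
  obtain ⟨n, rfl⟩ := Nat.exists_eq_add_one_of_ne_zero hN.ne'
  have hg_le : g x ≤ Vdpp A B F g φ (n + 1) x := by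
    obtain ⟨b⟩ := ‹Nonempty B›
    refine le_ciSup_of_le
      (bddAbove_range_iInf_stage (continuous_Vdpp hF hg hφ n) hF hg x) b ?_
    exact le_ciInf fun a => le_sup_left
  rw [flemingV0, altVal_eq_sup_Vdpp hF hg hφ (n + 1) (g x) x, sup_eq_right.2 hg_le]
  intro a b
  refine ⟨extp hN fun i => (a i : Euc nA), extp hN fun i => (b i : Euc nB),
    extp_coe hN _, extp_coe hN _, ?_⟩
  rw [J0, payoff_eq_runningPayoff g φ hN, runningPayoff_oTraj_succ, ← sup_assoc, sup_idem]

theorem tV0_eq_Vdpp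
    (hF : Continuous fun p : Euc d × Euc nA × Euc nB => F p.1 p.2.1 p.2.2)
    (hg : Continuous g) (hφ : Continuous φ) {N : ℕ} (hN : 0 < N) (x : Euc d) :
    tV0 A B F g φ hN x = Vdpp A B F g φ N x := by
  have : Nonempty (Gm d A B) :=
    ⟨⟨fun _ => Classical.arbitrary A, measurable_const⟩⟩
  have hlower : ∀ α : Fin N → Gm d A B,
      Vdpp A B F g φ N x ≤ ⨆ b : Fin N → B, tJ0 F g φ hN x (fun k => (α k).1) b := by
    intro α
    obtain ⟨C, hC⟩ := exists_runningPayoff_fbTraj_le (A := A) (B := B) hF hg hφ N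
      (isCompact_singleton (x := x))
    obtain ⟨b, hb⟩ := exists_Vdpp_le_runningPayoff hF hg hφ N x (extp hN fun k => (α k).1)
    refine le_ciSup_of_le ⟨C, ?_⟩ b ?_
    · rintro _ ⟨b', rfl⟩
      simp only [tJ0, payoff_eq_runningPayoff g φ hN]
      exact hC x rfl _ _
    · rw [tJ0, payoff_eq_runningPayoff g φ hN]
      exact hb _ (extp_coe hN b)
  refine le_antisymm (le_of_forall_pos_le_add fun ε hε => ?_) (le_ciInf hlower)
  have hN' : (0 : ℝ) < N := Nat.cast_pos.2 hN
  choose s hs hle using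
    exists_measurable_stage_le (A := A) (B := B) hF hg hφ (div_pos hε hN')
  refine ciInf_le_of_le ⟨_, forall_mem_range.2 hlower⟩
    (fun k => ⟨s (N - 1 - k), hs _⟩ : Fin N → Gm d A B) (ciSup_le fun b => ?_)
  rw [tJ0, payoff_eq_runningPayoff g φ hN]
  refine (runningPayoff_fbTraj_le_Vdpp_add (div_pos hε hN').le N x _ _ ?_).trans_eq ?_
  · intro k m hkm y b
    rw [extp_coe hN _ (⟨k, by omega⟩ : Fin N)]
    obtain rfl : m = N - 1 - k := by omega
    exact hle _ y b
  · rw [mul_div_cancel₀ _ hN'.ne']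

end Game

theorem feedback_value_eq_fleming {d nA nB : ℕ} (hnA : 1 ≤ nA) (hnB : 1 ≤ nB)
    (A : Set (Euc nA)) (B : Set (Euc nB))
    (hAne : A.Nonempty) (hAc : IsCompact A) (hBne : B.Nonempty) (hBc : IsCompact B)
    (F : Euc d → Euc nA → Euc nB → Euc d)
    (hF : Continuous fun p : Euc d × Euc nA × Euc nB => F p.1 p.2.1 p.2.2)
    (g φ : Euc d → ℝ) (Kg Kφ : NNReal) (hg : LipschitzWith Kg g) (hφ : LipschitzWith Kφ φ)
    (N : ℕ) (hN : 0 < N) (x : Euc d) :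
    tV0 A B F g φ hN x = flemingV0 A B F g φ hN x := by
  have : CompactSpace A := isCompact_iff_compactSpace.1 hAc
  have : CompactSpace B := isCompact_iff_compactSpace.1 hBc
  have : Nonempty A := hAne.to_subtype
  have : Nonempty B := hBne.to_subtype
  rw [tV0_eq_Vdpp hF hg.continuous hφ.continuous hN x,
    flemingV0_eq_Vdpp hF hg.continuous hφ.continuous hN x]

end
end

section
/- Assume the dynamics has a separate dependency in the controls, f(x,a,b) = f_1(x,a) + f_2(x,b) with f_1, f_2 Lipschitz continuous, and that the sets f_1(x,A) and f_2(x,B) are convex for every x ∈ ℝ^d. Consider the Euler scheme F(x,a,b) = x + τ f(x,a,b) with time step τ = T/N. Then there exists a constant C ≥ 0, depending only on T and on the data, such that for every integer N ≥ 1 and every x ∈ ℝ^d, |v_0(x) − V_0(x)| ≤ C (1 + |x|) τ. -/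
open MeasureTheory Set

noncomputable section

/-- measurable open-loop controls with values in `S` -/
def Cm {n : ℕ} (S : Set (Euc n)) : Type := {u : ℝ → S // Measurable u}

/-- non-anticipativity for continuous-time strategies -/
def NonAntC {nA nB : ℕ} (A : Set (Euc nA)) (B : Set (Euc nB)) (T : ℝ)
    (α : Cm B → Cm A) : Prop :=
  ∀ t ∈ Icc (0 : ℝ) T, ∀ b b' : Cm B,
    (∀ᵐ s ∂(volume.restrict (Icc (0 : ℝ) t)), b.1 s = b'.1 s) →
    ∀ᵐ s ∂(volume.restrict (Icc (0 : ℝ) t)), (α b).1 s = (α b').1 s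

/-- Carathéodory solution of `ẏ = f(y,a,b)` on `[0,T]`, `y(0) = x` -/
def IsSol {d nA nB : ℕ} (f : Euc d → Euc nA → Euc nB → Euc d) (T : ℝ) (x : Euc d)
    (a : ℝ → Euc nA) (b : ℝ → Euc nB) (y : ℝ → Euc d) : Prop :=
  ContinuousOn y (Icc 0 T) ∧ y 0 = x ∧
    ∀ t ∈ Icc (0 : ℝ) T, y t = x + ∫ s in (0 : ℝ)..t, f (y s) (a s) (b s)

/-- continuous-time payoff `(max_{s ∈ (0,T)} g(y(s))) ⊔ φ(y(T))` -/
def cPayoff {d : ℕ} (g φ : Euc d → ℝ) (T : ℝ) (y : ℝ → Euc d) : ℝ :=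
  (⨆ s : Ioo (0 : ℝ) T, g (y s)) ⊔ φ (y T)

/-- value of the continuous-time game -/
def v0c {d nA nB : ℕ} (A : Set (Euc nA)) (B : Set (Euc nB))
    (f : Euc d → Euc nA → Euc nB → Euc d) (g φ : Euc d → ℝ) (T : ℝ) (x : Euc d) : ℝ :=
  ⨅ α : {α : Cm B → Cm A // NonAntC A B T α}, ⨆ b : Cm B,
    sSup {r : ℝ | ∃ y : ℝ → Euc d,
      IsSol f T x (fun s => ((α.1 b).1 s : Euc nA)) (fun s => (b.1 s : Euc nB)) y ∧
        r = cPayoff g φ T y}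

lemma le_exp_mul_of_le_one_add_mul {w : ℕ → ℝ} {h : ℝ} {N : ℕ} (hh : 0 ≤ h) (h0 : 0 ≤ w 0)
    (hw : ∀ k < N, w (k + 1) ≤ (1 + h) * w k) {k : ℕ} (hk : k ≤ N) :
    w k ≤ Real.exp (N * h) * w 0 := by
  have hpow : ∀ k ≤ N, w k ≤ (1 + h) ^ k * w 0 := by
    intro k
    induction k with
    | zero => simp
    | succ k ih =>
      intro hk
      calc w (k + 1) ≤ (1 + h) * w k := hw k hk
        _ ≤ (1 + h) * ((1 + h) ^ k * w 0) :=
            mul_le_mul_of_nonneg_left (ih (by omega)) (by positivity)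
        _ = _ := by ring
  refine (hpow k hk).trans (mul_le_mul_of_nonneg_right ?_ h0)
  calc (1 + h) ^ k ≤ (1 + h) ^ N := pow_le_pow_right₀ (by linarith) hk
    _ ≤ Real.exp h ^ N := pow_le_pow_left₀ (by positivity) (by linarith [Real.add_one_le_exp h]) N
    _ = Real.exp (N * h) := (Real.exp_nat_mul h N).symm

section Ode

lemma norm_integral_le_of_norm_le_exp {E : Type*} [NormedAddCommGroup E] [NormedSpace ℝ E]
    {h : ℝ → E} {m l t : ℝ} (hl : 0 < l) (hm : 0 ≤ m) (ht : 0 ≤ t)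
    (hh : ∀ s ∈ Icc 0 t, ‖h s‖ ≤ m * Real.exp (l * s)) :
    ‖∫ s in (0 : ℝ)..t, h s‖ ≤ m / l * Real.exp (l * t) := by
  have hfi : IntervalIntegrable (fun s => m * Real.exp (l * s)) volume 0 t :=
    Continuous.intervalIntegrable (by fun_prop) _ _
  have hderiv : ∀ s ∈ uIcc 0 t,
      HasDerivAt (fun s => m / l * Real.exp (l * s)) (m * Real.exp (l * s)) s := by
    intro s _
    have h1 : HasDerivAt (fun s : ℝ => l * s) l s := by
      simpa using (hasDerivAt_id s).const_mul l
    have h2 : m * Real.exp (l * s) = m / l * (Real.exp (l * s) * l) := by field_simp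
    rw [h2]
    exact h1.exp.const_mul (m / l)
  calc ‖∫ s in (0 : ℝ)..t, h s‖ ≤ ∫ s in (0 : ℝ)..t, m * Real.exp (l * s) :=
        intervalIntegral.norm_integral_le_of_norm_le ht
          (Filter.Eventually.of_forall fun s hs => hh s ⟨hs.1.le, hs.2⟩) hfi
    _ = m / l * Real.exp (l * t) - m / l * Real.exp (l * 0) :=
        intervalIntegral.integral_eq_sub_of_hasDerivAt hderiv hfi
    _ ≤ m / l * Real.exp (l * t) := by
        have : 0 ≤ m / l * Real.exp (l * 0) := by positivity
        linarith

variable {E : Type*} [NormedAddCommGroup E] [MeasurableSpace E]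

/-- A time-dependent vector field which is measurable, Lipschitz in space uniformly in time,
and of linear growth. -/
structure IsCaratheodoryField (F : E → ℝ → E) (L c : ℝ) : Prop where
  measurable : Measurable fun p : E × ℝ => F p.1 p.2
  lipschitz : ∀ z w s, ‖F z s - F w s‖ ≤ L * ‖z - w‖
  growth : ∀ z s, ‖F z s‖ ≤ c * (1 + ‖z‖)
  lipschitz_nonneg : 0 ≤ L
  growth_nonneg : 0 ≤ c

lemma IsCaratheodoryField.intervalIntegrable [BorelSpace E] [SecondCountableTopology E]
    {F : E → ℝ → E} {L c : ℝ} (hF : IsCaratheodoryField F L c) {y : ℝ → E} {a b : ℝ}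
    (hy : ContinuousOn y (uIcc a b)) : IntervalIntegrable (fun s => F (y s) s) volume a b := by
  have hmeas : AEStronglyMeasurable (fun s => F (y s) s) (volume.restrict (uIoc a b)) := by
    have hy' : AEMeasurable y (volume.restrict (uIoc a b)) :=
      ((hy.aemeasurable measurableSet_uIcc)).mono_measure
        (Measure.restrict_mono uIoc_subset_uIcc le_rfl)
    exact (hF.measurable.comp_aemeasurable (hy'.prodMk aemeasurable_id)).aestronglyMeasurable
  have hb : IntervalIntegrable (fun s => c * (1 + ‖y s‖)) volume a b :=
    (continuousOn_const.mul (continuousOn_const.add hy.norm)).intervalIntegrable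
  refine hb.mono_fun hmeas (Filter.Eventually.of_forall fun s => ?_)
  exact (hF.growth _ _).trans (le_abs_self _)

variable [NormedSpace ℝ E]

/-- Integral solutions on `[0, T]` of the initial value problem for the field `F`. -/
def IsIntegralSol (F : E → ℝ → E) (T : ℝ) (x : E) (y : ℝ → E) : Prop :=
  ContinuousOn y (Icc 0 T) ∧ y 0 = x ∧ ∀ t ∈ Icc (0 : ℝ) T, y t = x + ∫ s in (0 : ℝ)..t, F (y s) s

namespace IsCaratheodoryField

variable {F : E → ℝ → E} {L c : ℝ}

lemma exists_isIntegralSol [BorelSpace E] [SecondCountableTopology E] [CompleteSpace E]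
    (hF : IsCaratheodoryField F L c) {T : ℝ} (hT : 0 ≤ T) (x : E) :
    ∃ y, IsIntegralSol F T x y := by
  have hL := hF.lipschitz_nonneg
  set l : ℝ := 2 * L + 1 with hl
  have hl0 : 0 < l := by positivity
  let ext : C(Icc (0 : ℝ) T, E) → ℝ → E := fun z s => Real.exp (l * s) • z (projIcc 0 T hT s)
  have hext : ∀ z, Continuous (ext z) := fun z =>
    (Real.continuous_exp.comp (continuous_const.mul continuous_id)).smul
      (z.continuous.comp continuous_projIcc)
  have hii : ∀ z a b, IntervalIntegrable (fun s => F (ext z s) s) volume a b := fun z a b =>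
    hF.intervalIntegrable (hext z).continuousOn
  let Φ : C(Icc (0 : ℝ) T, E) → C(Icc (0 : ℝ) T, E) := fun z =>
    ⟨fun t => Real.exp (-(l * t)) • (x + ∫ s in (0 : ℝ)..t, F (ext z s) s), by
      have h1 := (intervalIntegral.continuous_primitive (hii z) 0).comp
        (continuous_subtype_val (p := fun t => t ∈ Icc (0 : ℝ) T))
      exact (Real.continuous_exp.comp (continuous_const.mul continuous_subtype_val).neg).smul
        (continuous_const.add h1)⟩
  have hΦ : ContractingWith (1 / 2) Φ := by
    refine ⟨by rw [← NNReal.coe_lt_coe]; norm_num, LipschitzWith.of_dist_le_mul fun z w => ?_⟩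
    have hD : (0 : ℝ) ≤ dist z w := dist_nonneg
    refine (ContinuousMap.dist_le (by positivity)).2 fun t => ?_
    have ht0 : (0 : ℝ) ≤ t := t.2.1
    have hsub : Φ z t - Φ w t =
        Real.exp (-(l * t)) • ∫ s in (0 : ℝ)..t, (F (ext z s) s - F (ext w s) s) := by
      rw [intervalIntegral.integral_sub (hii z _ _) (hii w _ _)]
      simp only [Φ, ContinuousMap.coe_mk, ← smul_sub]
      congr 1
      abel
    have hbound : ‖∫ s in (0 : ℝ)..t, (F (ext z s) s - F (ext w s) s)‖ ≤
        L * dist z w / l * Real.exp (l * t) := by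
      refine norm_integral_le_of_norm_le_exp hl0 (by positivity) ht0 fun s _ => ?_
      refine (hF.lipschitz _ _ _).trans ?_
      rw [mul_assoc]
      refine mul_le_mul_of_nonneg_left ?_ hL
      simp only [ext, ← smul_sub, norm_smul, Real.norm_eq_abs, Real.abs_exp]
      rw [mul_comm, ← dist_eq_norm]
      exact mul_le_mul_of_nonneg_right (ContinuousMap.dist_apply_le_dist _) (Real.exp_nonneg _)
    rw [dist_eq_norm, hsub, norm_smul, Real.norm_eq_abs, Real.abs_exp]
    calc Real.exp (-(l * t)) * ‖∫ s in (0 : ℝ)..t, (F (ext z s) s - F (ext w s) s)‖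
        ≤ Real.exp (-(l * t)) * (L * dist z w / l * Real.exp (l * t)) :=
          mul_le_mul_of_nonneg_left hbound (Real.exp_nonneg _)
      _ = L / l * dist z w := by rw [Real.exp_neg]; field_simp
      _ ≤ ((1 / 2 : NNReal) : ℝ) * dist z w := by
          refine mul_le_mul_of_nonneg_right ?_ hD
          rw [div_le_iff₀ hl0]
          push_cast
          linarith
  have hfix : Φ (ContractingWith.fixedPoint Φ hΦ) = ContractingWith.fixedPoint Φ hΦ :=
    hΦ.fixedPoint_isFixedPt
  set z := ContractingWith.fixedPoint Φ hΦ
  have hsol : ∀ t ∈ Icc (0 : ℝ) T, ext z t = x + ∫ s in (0 : ℝ)..t, F (ext z s) s := by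
    intro t ht
    have h1 : z ⟨t, ht⟩ = Real.exp (-(l * t)) • (x + ∫ s in (0 : ℝ)..t, F (ext z s) s) := by
      conv_lhs => rw [← hfix]
      rfl
    have h2 : ext z t = Real.exp (l * t) • z ⟨t, ht⟩ := by
      simp only [ext, projIcc_of_mem hT ht]
    rw [h2, h1, smul_smul, ← Real.exp_add]
    simp
  refine ⟨ext z, (hext z).continuousOn, ?_, hsol⟩
  simpa using hsol 0 ⟨le_rfl, hT⟩

lemma norm_le_of_isIntegralSol (hF : IsCaratheodoryField F L c) {T : ℝ} (hT : 0 ≤ T) {x : E}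
    {y : ℝ → E} (hy : IsIntegralSol F T x y) {t : ℝ} (ht : t ∈ Icc 0 T) :
    1 + ‖y t‖ ≤ 2 * Real.exp ((2 * c + 1) * T) * (1 + ‖x‖) := by
  have hc := hF.growth_nonneg
  set l : ℝ := 2 * c + 1 with hl
  have hl0 : 0 < l := by positivity
  obtain ⟨r, hr, hmax⟩ := isCompact_Icc.exists_isMaxOn (nonempty_Icc.2 hT)
    (f := fun s => Real.exp (-(l * s)) * (1 + ‖y s‖))
    ((by fun_prop : Continuous fun s : ℝ => Real.exp (-(l * s))).continuousOn.mul
      (continuousOn_const.add hy.1.norm))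
  set m := Real.exp (-(l * r)) * (1 + ‖y r‖) with hm
  have hm0 : 0 ≤ m := by positivity
  have hle : ∀ s ∈ Icc 0 T, 1 + ‖y s‖ ≤ m * Real.exp (l * s) := by
    intro s hs
    have h1 : Real.exp (-(l * s)) * (1 + ‖y s‖) ≤ m := hmax hs
    rw [Real.exp_neg] at h1
    rwa [inv_mul_le_iff₀ (Real.exp_pos _), mul_comm] at h1
  have hfi : ‖∫ s in (0 : ℝ)..r, F (y s) s‖ ≤ c * m / l * Real.exp (l * r) := by
    refine norm_integral_le_of_norm_le_exp hl0 (by positivity) hr.1 fun s hs => ?_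
    refine (hF.growth _ _).trans ?_
    rw [mul_assoc]
    exact mul_le_mul_of_nonneg_left (hle s ⟨hs.1, hs.2.trans hr.2⟩) hc
  have hyr : 1 + ‖y r‖ ≤ 1 + ‖x‖ + c * m / l * Real.exp (l * r) := by
    rw [hy.2.2 r hr]
    linarith [norm_add_le x (∫ s in (0 : ℝ)..r, F (y s) s)]
  have hexp : Real.exp (-(l * r)) ≤ 1 :=
    Real.exp_le_one_iff.2 (by nlinarith [hr.1])
  have hm2 : m ≤ 1 + ‖x‖ + c / l * m := by
    calc m ≤ Real.exp (-(l * r)) * (1 + ‖x‖ + c * m / l * Real.exp (l * r)) :=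
          mul_le_mul_of_nonneg_left hyr (Real.exp_nonneg _)
      _ = Real.exp (-(l * r)) * (1 + ‖x‖) + c / l * m := by
          rw [Real.exp_neg]; field_simp
      _ ≤ 1 * (1 + ‖x‖) + c / l * m := by gcongr
      _ = _ := by ring
  have hcl : c / l ≤ 1 / 2 := by rw [div_le_iff₀ hl0]; linarith
  have hm3 : m ≤ 2 * (1 + ‖x‖) := by nlinarith
  calc 1 + ‖y t‖ ≤ m * Real.exp (l * t) := hle t ht
    _ ≤ 2 * (1 + ‖x‖) * Real.exp (l * T) := by
        have := ht.2
        gcongr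
    _ = _ := by ring

lemma norm_sub_le_of_isIntegralSol [BorelSpace E] [SecondCountableTopology E]
    (hF : IsCaratheodoryField F L c) {T R : ℝ} {x : E} {y : ℝ → E} (hy : IsIntegralSol F T x y)
    (hR : ∀ t ∈ Icc 0 T, 1 + ‖y t‖ ≤ R) {s t : ℝ} (hs : 0 ≤ s) (hst : s ≤ t) (ht : t ≤ T) :
    y t - y s = (∫ r in s..t, F (y r) r) ∧ ‖y t - y s‖ ≤ c * R * (t - s) := by
  have hii : ∀ a ∈ Icc 0 T, ∀ b ∈ Icc 0 T,
      IntervalIntegrable (fun s => F (y s) s) volume a b := fun a ha b hb =>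
    hF.intervalIntegrable (hy.1.mono (uIcc_subset_Icc ha hb))
  have hT : 0 ≤ T := hs.trans (hst.trans ht)
  have heq : y t - y s = ∫ r in s..t, F (y r) r := by
    rw [hy.2.2 t ⟨hs.trans hst, ht⟩, hy.2.2 s ⟨hs, hst.trans ht⟩, add_sub_add_left_eq_sub]
    exact intervalIntegral.integral_interval_sub_left
      (hii 0 ⟨le_rfl, hT⟩ t ⟨hs.trans hst, ht⟩) (hii 0 ⟨le_rfl, hT⟩ s ⟨hs, hst.trans ht⟩)
  refine ⟨heq, ?_⟩
  rw [heq, ← abs_of_nonneg (sub_nonneg.2 hst)]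
  refine intervalIntegral.norm_integral_le_of_norm_le_const fun r hr => ?_
  rw [uIoc_of_le hst] at hr
  exact (hF.growth _ _).trans (mul_le_mul_of_nonneg_left
    (hR r ⟨hs.trans hr.1.le, hr.2.trans ht⟩) hF.growth_nonneg)

/-- The error at the grid points between an integral solution of `F` and a sequence of one-step
increments is controlled by the accumulated defect of the increments and by the step size. -/
lemma norm_sub_le_of_defect_le [BorelSpace E] [SecondCountableTopology E]
    (hF : IsCaratheodoryField F L c) {T R τ η : ℝ} {N : ℕ} (hτ : 0 ≤ τ) (hN : N * τ = T)
    {x : E} {y : ℝ → E} (hy : IsIntegralSol F T x y) (hR : ∀ t ∈ Icc 0 T, 1 + ‖y t‖ ≤ R)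
    {X p : ℕ → E} (hX0 : X 0 = x) (hX : ∀ k < N, X (k + 1) = X k + p k)
    (hη : ∀ k ≤ N, ‖∑ j ∈ Finset.range k,
      ((∫ s in (j * τ)..((j + 1) * τ), F (X j) s) - p j)‖ ≤ η)
    {k : ℕ} (hk : k ≤ N) :
    ‖y (k * τ) - X k‖ ≤ Real.exp (L * T) * (η + c * R * τ) := by
  have hL := hF.lipschitz_nonneg
  have hc := hF.growth_nonneg
  have hT : 0 ≤ T := hN ▸ by positivity
  have hR0 : 0 ≤ R := le_trans (by positivity) (hR 0 ⟨le_rfl, hT⟩)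
  set D : ℕ → E := fun k => ∑ j ∈ Finset.range k,
    ((∫ s in (j * τ)..((j + 1) * τ), F (X j) s) - p j) with hD
  have hη0 : 0 ≤ η := (norm_nonneg _).trans (hη 0 (Nat.zero_le _))
  set w : ℕ → ℝ := fun k => ‖y (k * τ) - X k - D k‖ + η + c * R * τ with hw
  have herr : ∀ k ≤ N, ‖y (k * τ) - X k‖ ≤ ‖y (k * τ) - X k - D k‖ + η := fun k hk => by
    have h1 := norm_add_le (y (k * τ) - X k - D k) (D k)
    rw [sub_add_cancel] at h1
    exact h1.trans (by linarith [hη k hk])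
  have hw0 : w 0 = η + c * R * τ := by simp [hw, hD, hX0, hy.2.1]
  have hstep : ∀ k < N, w (k + 1) ≤ (1 + L * τ) * w k := by
    intro k hk
    have hk0 : (0 : ℝ) ≤ k * τ := by positivity
    have hk1 : (k : ℝ) * τ ≤ (k + 1) * τ := by nlinarith
    have hk2 : ((k : ℝ) + 1) * τ ≤ T := by
      rw [← hN]
      exact mul_le_mul_of_nonneg_right (by exact_mod_cast hk) hτ
    have hi1 : IntervalIntegrable (fun s => F (y s) s) volume (k * τ) ((k + 1) * τ) :=
      hF.intervalIntegrable (hy.1.mono (uIcc_subset_Icc ⟨hk0, hk1.trans hk2⟩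
        ⟨hk0.trans hk1, hk2⟩))
    have hi2 : IntervalIntegrable (fun s => F (X k) s) volume (k * τ) ((k + 1) * τ) :=
      hF.intervalIntegrable continuousOn_const
    have heq : y ((k + 1) * τ) - X (k + 1) - D (k + 1) = (y (k * τ) - X k - D k) +
        ∫ s in (k * τ)..((k + 1) * τ), (F (y s) s - F (X k) s) := by
      rw [intervalIntegral.integral_sub hi1 hi2,
        ← (hF.norm_sub_le_of_isIntegralSol hy hR hk0 hk1 hk2).1, hX k hk]
      simp only [hD, Finset.sum_range_succ]
      abel
    have hb : ‖∫ s in (k * τ)..((k + 1) * τ), (F (y s) s - F (X k) s)‖ ≤ L * w k * τ := by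
      have hlen : |((k : ℝ) + 1) * τ - k * τ| = τ := by
        rw [show ((k : ℝ) + 1) * τ - k * τ = τ by ring, abs_of_nonneg hτ]
      rw [← congrArg (L * w k * ·) hlen]
      refine intervalIntegral.norm_integral_le_of_norm_le_const fun r hr => ?_
      rw [uIoc_of_le hk1] at hr
      refine (hF.lipschitz _ _ _).trans (mul_le_mul_of_nonneg_left ?_ hL)
      have h1 := (hF.norm_sub_le_of_isIntegralSol hy hR hk0 hr.1.le (hr.2.trans hk2)).2
      have h2 : c * R * (r - k * τ) ≤ c * R * τ := by
        refine mul_le_mul_of_nonneg_left ?_ (by positivity)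
        linarith [hr.2]
      have h3 := norm_sub_le_norm_sub_add_norm_sub (y r) (y (k * τ)) (X k)
      simp only [hw]
      linarith [herr k hk.le]
    calc w (k + 1) = ‖y ((k + 1) * τ) - X (k + 1) - D (k + 1)‖ + η + c * R * τ := by
          simp only [hw]; push_cast; rfl
      _ ≤ ‖y (k * τ) - X k - D k‖ + L * w k * τ + η + c * R * τ := by
          rw [heq]
          linarith [norm_add_le (y (k * τ) - X k - D k)
            (∫ s in (k * τ)..((k + 1) * τ), (F (y s) s - F (X k) s))]
      _ = (1 + L * τ) * w k := by simp only [hw]; ring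
  have h1 := le_exp_mul_of_le_one_add_mul (w := w) (by positivity)
    (hw0 ▸ by positivity) hstep hk
  rw [hw0, show (N : ℝ) * (L * τ) = L * T by rw [← hN]; ring] at h1
  refine le_trans ?_ h1
  have : 0 ≤ c * R * τ := by positivity
  simp only [hw]
  linarith [herr k hk]

end IsCaratheodoryField

end Ode

section Values

lemma abs_sup_sub_sup_le {a b c d δ : ℝ} (h1 : |a - c| ≤ δ) (h2 : |b - d| ≤ δ) :
    |a ⊔ b - c ⊔ d| ≤ δ :=
  (abs_max_sub_max_le_max a b c d).trans (max_le h1 h2)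

lemma abs_sSup_sub_le {S : Set ℝ} (hS : S.Nonempty) {p e : ℝ} (h : ∀ r ∈ S, |r - p| ≤ e) :
    |sSup S - p| ≤ e := by
  have hle : ∀ r ∈ S, r ≤ p + e := fun r hr => by linarith [(abs_le.1 (h r hr)).2]
  obtain ⟨r, hr⟩ := hS
  rw [abs_le]
  constructor
  · linarith [le_csSup ⟨p + e, hle⟩ hr, (abs_le.1 (h r hr)).1]
  · linarith [csSup_le ⟨r, hr⟩ hle]

lemma iInf_iSup_le_iInf_iSup_add {I J I' J' : Type*} [Nonempty J] [Nonempty I'] [Nonempty J']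
    {Φ : I → J → ℝ} {Ψ : I' → J' → ℝ} {M e : ℝ} (hΦ : ∀ i j, |Φ i j| ≤ M)
    (hΨ : ∀ i j, |Ψ i j| ≤ M) (h : ∀ i', ∃ i, ∀ j, ∃ j', Φ i j ≤ Ψ i' j' + e) :
    (⨅ i, ⨆ j, Φ i j) ≤ (⨅ i, ⨆ j, Ψ i j) + e := by
  have hbddΦ : ∀ i, BddAbove (range (Φ i)) := fun i =>
    ⟨M, by rintro _ ⟨j, rfl⟩; exact (abs_le.1 (hΦ i j)).2⟩
  have hbddΨ : ∀ i, BddAbove (range (Ψ i)) := fun i =>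
    ⟨M, by rintro _ ⟨j, rfl⟩; exact (abs_le.1 (hΨ i j)).2⟩
  have hbelow : BddBelow (range fun i => ⨆ j, Φ i j) := by
    refine ⟨-M, ?_⟩
    rintro _ ⟨i, rfl⟩
    obtain ⟨j⟩ := ‹Nonempty J›
    exact (abs_le.1 (hΦ i j)).1.trans (le_ciSup (hbddΦ i) j)
  rw [← sub_le_iff_le_add]
  refine le_ciInf fun i' => ?_
  obtain ⟨i, hi⟩ := h i'
  rw [sub_le_iff_le_add]
  refine (ciInf_le hbelow i).trans (ciSup_le fun j => ?_)
  obtain ⟨j', hj'⟩ := hi j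
  linarith [le_ciSup (hbddΨ i') j']

variable {d : ℕ} {g φ : Euc d → ℝ}

lemma abs_payoff_sub_payoff_le {K δ : ℝ} (hK : 0 ≤ K) (hg : ∀ z w, |g z - g w| ≤ K * ‖z - w‖)
    (hφ : ∀ z w, |φ z - φ w| ≤ K * ‖z - w‖) {N : ℕ} (hN : 0 < N) {X X' : ℕ → Euc d}
    (h : ∀ k ≤ N, ‖X k - X' k‖ ≤ δ) : |payoff g φ N X - payoff g φ N X'| ≤ K * δ := by
  have : Nonempty (Fin N) := ⟨⟨0, hN⟩⟩
  refine abs_sup_sub_sup_le ?_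
    ((hφ _ _).trans (mul_le_mul_of_nonneg_left (h N le_rfl) hK))
  have key : ∀ Y Y' : ℕ → Euc d, (∀ k ≤ N, ‖Y k - Y' k‖ ≤ δ) →
      (⨆ k : Fin N, g (Y k)) ≤ (⨆ k : Fin N, g (Y' k)) + K * δ := fun Y Y' hY => by
    refine ciSup_le fun k => ?_
    have h1 := le_ciSup (f := fun k : Fin N => g (Y' k)) (Set.finite_range _).bddAbove k
    have h2 := (hg (Y k) (Y' k)).trans (mul_le_mul_of_nonneg_left (hY k k.2.le) hK)
    linarith [(abs_le.1 h2).2]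
  rw [abs_le]
  constructor
  · linarith [key X' X fun k hk => by rw [norm_sub_rev]; exact h k hk]
  · linarith [key X X' h]

lemma payoff_congr {N : ℕ} {X X' : ℕ → Euc d} (h : ∀ k ≤ N, X k = X' k) :
    payoff g φ N X = payoff g φ N X' := by
  have h1 : ∀ k : Fin N, g (X k) = g (X' k) := fun k => by rw [h k k.2.le]
  simp only [payoff, h1, h N le_rfl]

lemma abs_payoff_le {M : ℝ} {N : ℕ} (hN : 0 < N) {X : ℕ → Euc d}
    (hg : ∀ k ≤ N, |g (X k)| ≤ M) (hφ : ∀ k ≤ N, |φ (X k)| ≤ M) : |payoff g φ N X| ≤ M := by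
  have : Nonempty (Fin N) := ⟨⟨0, hN⟩⟩
  have h := abs_sup_sub_sup_le (a := ⨆ k : Fin N, g (X k)) (b := φ (X N)) (c := 0) (d := 0)
    (δ := M) ?_ (by simpa using hφ N le_rfl)
  · simpa [payoff] using h
  · rw [sub_zero, abs_le]
    constructor
    · exact (abs_le.1 (hg 0 hN.le)).1.trans
        (le_ciSup (f := fun k : Fin N => g (X k)) (Set.finite_range _).bddAbove ⟨0, hN⟩)
    · exact ciSup_le fun k => (abs_le.1 (hg k k.2.le)).2

lemma abs_cPayoff_le {M T : ℝ} (hT : 0 < T) {y : ℝ → Euc d}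
    (hg : ∀ s ∈ Icc 0 T, |g (y s)| ≤ M) (hφ : ∀ s ∈ Icc 0 T, |φ (y s)| ≤ M) :
    |cPayoff g φ T y| ≤ M := by
  have hmem : T / 2 ∈ Ioo 0 T := ⟨by linarith, by linarith⟩
  have : Nonempty (Ioo (0 : ℝ) T) := ⟨⟨T / 2, hmem⟩⟩
  have hle : ∀ s : Ioo (0 : ℝ) T, |g (y s)| ≤ M := fun s => hg s (Ioo_subset_Icc_self s.2)
  have h := abs_sup_sub_sup_le (a := ⨆ s : Ioo (0 : ℝ) T, g (y s)) (b := φ (y T)) (c := 0)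
    (d := 0) (δ := M) ?_ (by simpa using hφ T ⟨hT.le, le_rfl⟩)
  · simpa [cPayoff] using h
  · rw [sub_zero, abs_le]
    constructor
    · refine (abs_le.1 (hle ⟨T / 2, hmem⟩)).1.trans
        (le_ciSup (f := fun s : Ioo (0 : ℝ) T => g (y s)) ⟨M, ?_⟩ ⟨T / 2, hmem⟩)
      rintro _ ⟨s, rfl⟩
      exact (abs_le.1 (hle s)).2
    · exact ciSup_le fun s => (abs_le.1 (hle s)).2

lemma natFloor_div_eq {τ s : ℝ} (hτ : 0 < τ) {k : ℕ} (hs : s ∈ Ico (k * τ) ((k + 1) * τ)) :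
    ⌊s / τ⌋₊ = k := by
  have hs0 : 0 ≤ s := le_trans (by positivity) hs.1
  rw [Nat.floor_eq_iff (by positivity), le_div_iff₀ hτ, div_lt_iff₀ hτ]
  exact hs

lemma mem_Ico_natFloor_div {τ s : ℝ} (hτ : 0 < τ) (hs : 0 ≤ s) :
    s ∈ Ico (⌊s / τ⌋₊ * τ) ((⌊s / τ⌋₊ + 1) * τ) := by
  constructor
  · rw [← le_div_iff₀ hτ]
    exact Nat.floor_le (by positivity)
  · rw [← div_lt_iff₀ hτ]
    exact Nat.lt_floor_add_one _

lemma abs_cPayoff_sub_payoff_le {K δ : ℝ} (hK : 0 ≤ K) (hg : ∀ z w, |g z - g w| ≤ K * ‖z - w‖)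
    (hφ : ∀ z w, |φ z - φ w| ≤ K * ‖z - w‖) {N : ℕ} (hN : 0 < N) {T τ : ℝ} (hτ : 0 < τ)
    (hNτ : N * τ = T) {X : ℕ → Euc d} {y : ℝ → Euc d}
    (h : ∀ k < N, ∀ s ∈ Icc (k * τ) ((k + 1) * τ), ‖y s - X k‖ ≤ δ) (hT : ‖y T - X N‖ ≤ δ) :
    |cPayoff g φ T y - payoff g φ N X| ≤ K * δ := by
  have hN' : (0 : ℝ) < N := by exact_mod_cast hN
  have : Nonempty (Fin N) := ⟨⟨0, hN⟩⟩
  have hT0 : 0 < T := hNτ ▸ by positivity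
  have : Nonempty (Ioo (0 : ℝ) T) := ⟨⟨T / 2, by linarith, by linarith⟩⟩
  refine abs_sup_sub_sup_le ?_ ((hφ _ _).trans (mul_le_mul_of_nonneg_left hT hK))
  have hclose : ∀ k < N, ∀ s ∈ Icc (k * τ) ((k + 1) * τ), |g (y s) - g (X k)| ≤ K * δ :=
    fun k hk s hs => (hg _ _).trans (mul_le_mul_of_nonneg_left (h k hk s hs) hK)
  have hle : ∀ s : Ioo (0 : ℝ) T, g (y s) ≤ (⨆ k : Fin N, g (X k)) + K * δ := by
    rintro ⟨s, hs⟩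
    have hk : ⌊s / τ⌋₊ < N := by
      rw [Nat.floor_lt (div_nonneg hs.1.le hτ.le), div_lt_iff₀ hτ, hNτ]
      exact hs.2
    have h1 := hclose _ hk s (Ico_subset_Icc_self (mem_Ico_natFloor_div hτ hs.1.le))
    have h2 := le_ciSup (f := fun k : Fin N => g (X k)) (Set.finite_range _).bddAbove ⟨_, hk⟩
    dsimp only at h2 ⊢
    linarith [(abs_le.1 h1).2]
  rw [abs_le]
  constructor
  · suffices (⨆ k : Fin N, g (X k)) ≤ (⨆ s : Ioo (0 : ℝ) T, g (y s)) + K * δ by linarith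
    refine ciSup_le fun k => ?_
    have hk1 : ((k : ℕ) : ℝ) + 1 ≤ N := by exact_mod_cast k.2
    have hmid : (((k : ℕ) : ℝ) + 1 / 2) * τ ∈ Ioo 0 T := by
      constructor
      · positivity
      · rw [← hNτ]
        exact mul_lt_mul_of_pos_right (by linarith) hτ
    have h1 := hclose k k.2 ((((k : ℕ) : ℝ) + 1 / 2) * τ) ⟨by nlinarith, by nlinarith⟩
    have h2 := le_ciSup (f := fun s : Ioo (0 : ℝ) T => g (y s))
      ⟨_, by rintro _ ⟨s, rfl⟩; exact hle s⟩ ⟨_, hmid⟩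
    dsimp only at h2
    linarith [(abs_le.1 h1).1]
  · linarith [ciSup_le hle]

end Values

section Causal

lemma exists_forall_eq_of_causal {S : Type*} [Nonempty S] {Φ : ℕ → (ℕ → S) → S}
    (hΦ : ∀ k h h', (∀ j < k, h j = h' j) → Φ k h = Φ k h') : ∃ h : ℕ → S, ∀ k, h k = Φ k h := by
  obtain ⟨s⟩ := ‹Nonempty S›
  let hist : ℕ → ℕ → S := fun n =>
    Nat.rec (fun _ => s) (fun k h => Function.update h k (Φ k h)) n
  have hsucc : ∀ k, hist (k + 1) = Function.update (hist k) k (Φ k (hist k)) := fun k => rfl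
  have hstable : ∀ j m, hist (j + 1 + m) j = hist (j + 1) j := by
    intro j m
    induction m with
    | zero => rfl
    | succ m ih =>
      rw [← add_assoc, hsucc, Function.update_of_ne (by omega), ih]
  refine ⟨fun k => hist (k + 1) k, fun k => ?_⟩
  change hist (k + 1) k = _
  rw [hsucc, Function.update_self]
  refine hΦ k _ _ fun j hj => ?_
  obtain ⟨m, rfl⟩ := Nat.exists_eq_add_of_le (Nat.succ_le_of_lt hj)
  exact hstable j m

lemma eq_of_causal {S : Type*} {Φ Φ' : ℕ → (ℕ → S) → S}
    (hΦ : ∀ k h h', (∀ j < k, h j = h' j) → Φ k h = Φ k h') {h h' : ℕ → S}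
    (hh : ∀ k, h k = Φ k h) (hh' : ∀ k, h' k = Φ' k h') {m : ℕ}
    (heq : ∀ k < m, ∀ q, Φ k q = Φ' k q) : ∀ k < m, h k = h' k := by
  intro k
  induction k using Nat.strong_induction_on with
  | _ k ih =>
    intro hk
    rw [hh k, hh' k, ← heq k hk]
    exact hΦ k _ _ fun j hj => ih j hj (hj.trans hk)

end Causal

section Game

lemma oTraj_congr {d nA nB : ℕ} {F : Euc d → Euc nA → Euc nB → Euc d} {x : Euc d}
    {a a' : ℕ → Euc nA} {b b' : ℕ → Euc nB} {k : ℕ} (ha : ∀ j < k, a j = a' j)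
    (hb : ∀ j < k, b j = b' j) : oTraj F x a b k = oTraj F x a' b' k := by
  induction k with
  | zero => rfl
  | succ k ih =>
    simp only [oTraj]
    rw [ih (fun j hj => ha j (by omega)) (fun j hj => hb j (by omega)), ha k (by omega),
      hb k (by omega)]

/-- The mean over an interval of a velocity ranging in a compact convex set is attained. -/
lemma exists_smul_eq_integral {d n : ℕ} {S : Set (Euc n)} (hS : IsCompact S) {v : Euc n → Euc d}
    (hv : Continuous v) (hconv : Convex ℝ (v '' S)) {u : ℝ → S} (hu : Measurable u) {p q : ℝ}
    (hpq : p < q) : ∃ a : S, (q - p) • v a = ∫ r in p..q, v (u r) := by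
  have hcomp : IsCompact (v '' S) := hS.image hv
  obtain ⟨M, hM⟩ := hcomp.isBounded.exists_norm_le
  have hmeas : Measurable fun r => v (u r) := hv.measurable.comp (measurable_subtype_coe.comp hu)
  have hfi : IntegrableOn (fun r => v (u r)) (Ioc p q) :=
    Measure.integrableOn_of_bounded (M := M) (by simp) hmeas.aestronglyMeasurable
      (Filter.Eventually.of_forall fun r => hM _ ⟨_, (u r).2, rfl⟩)
  obtain ⟨a, ha, hav⟩ := hconv.set_average_mem hcomp.isClosed (μ := volume) (t := Ioc p q)
    (by simp [hpq]) (by simp)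
    (Filter.Eventually.of_forall fun r => ⟨_, (u r).2, rfl⟩) hfi
  refine ⟨⟨a, ha⟩, ?_⟩
  rw [intervalIntegral.integral_of_le hpq.le]
  change (q - p) • v a = _
  rw [hav, setAverage_eq, smul_smul]
  simp [Measure.real, hpq.le, (sub_pos.2 hpq).ne']

/-- One step of size `τ` of the Euler scheme for the dynamics `f₁ x a + f₂ x b`. -/
abbrev eulerStep {d nA nB : ℕ} (f1 : Euc d → Euc nA → Euc d) (f2 : Euc d → Euc nB → Euc d)
    (τ : ℝ) (z : Euc d) (a : Euc nA) (b : Euc nB) : Euc d :=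
  z + τ • (f1 z a + f2 z b)

/-- Accumulated difference over the first `k` cells between the continuous-time velocities,
frozen along the discrete trajectory, and the Euler increments. -/
def eulerDefect {d nA nB : ℕ} (f1 : Euc d → Euc nA → Euc d) (f2 : Euc d → Euc nB → Euc d)
    (τ : ℝ) (x : Euc d) (u : ℝ → Euc nA) (v : ℝ → Euc nB) (a : ℕ → Euc nA) (b : ℕ → Euc nB)
    (k : ℕ) : Euc d :=
  ∑ j ∈ Finset.range k,
    ((∫ s in (j * τ)..((j + 1) * τ), (f1 (oTraj (eulerStep f1 f2 τ) x a b j) (u s) +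
      f2 (oTraj (eulerStep f1 f2 τ) x a b j) (v s))) -
      τ • (f1 (oTraj (eulerStep f1 f2 τ) x a b j) (a j) +
        f2 (oTraj (eulerStep f1 f2 τ) x a b j) (b j)))

lemma integral_congr_of_ae_restrict_Icc {d n : ℕ} {S : Set (Euc n)} (v : Euc n → Euc d)
    {u u' : ℝ → S} {t p q : ℝ} (h : ∀ᵐ s ∂(volume.restrict (Icc (0 : ℝ) t)), u s = u' s)
    (hp : 0 ≤ p) (hpq : p ≤ q) (hq : q ≤ t) :
    ∫ s in p..q, v (u s) = ∫ s in p..q, v (u' s) := by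
  rw [ae_restrict_iff' measurableSet_Icc] at h
  refine intervalIntegral.integral_congr_ae ?_
  filter_upwards [h] with s hs hmem
  rw [uIoc_of_le hpq] at hmem
  rw [hs ⟨hp.trans hmem.1.le, hmem.2.trans hq⟩]

/-- Quantitative regularity of a dynamics `f₁ x a + f₂ x b` with separated controls. -/
structure IsSeparatedGame {d nA nB : ℕ} (A : Set (Euc nA)) (B : Set (Euc nB))
    (f1 : Euc d → Euc nA → Euc d) (f2 : Euc d → Euc nB → Euc d) (L c : ℝ) : Prop where
  cont1 : Continuous fun p : Euc d × Euc nA => f1 p.1 p.2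
  cont2 : Continuous fun p : Euc d × Euc nB => f2 p.1 p.2
  lip1 : ∀ z w a, ‖f1 z a - f1 w a‖ ≤ L * ‖z - w‖
  lip2 : ∀ z w b, ‖f2 z b - f2 w b‖ ≤ L * ‖z - w‖
  lip_control : ∀ z b b', ‖f2 z b - f2 z b'‖ ≤ L * ‖b - b'‖
  growth1 : ∀ z, ∀ a ∈ A, ‖f1 z a‖ ≤ c * (1 + ‖z‖)
  growth2 : ∀ z, ∀ b ∈ B, ‖f2 z b‖ ≤ c * (1 + ‖z‖)
  lip_nonneg : 0 ≤ L
  growth_nonneg : 0 ≤ c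

namespace IsSeparatedGame

variable {d nA nB : ℕ} {A : Set (Euc nA)} {B : Set (Euc nB)} {f1 : Euc d → Euc nA → Euc d}
  {f2 : Euc d → Euc nB → Euc d} {L c : ℝ}

lemma exists_of_lipschitzWith (hA : IsCompact A) (hB : IsCompact B) {K1 K2 : NNReal}
    (hf1 : LipschitzWith K1 fun p : Euc d × Euc nA => f1 p.1 p.2)
    (hf2 : LipschitzWith K2 fun p : Euc d × Euc nB => f2 p.1 p.2) :
    ∃ L c, IsSeparatedGame A B f1 f2 L c := by
  have hgrowth : ∀ {n : ℕ} {S : Set (Euc n)} (_ : IsCompact S) {v : Euc d → Euc n → Euc d}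
      {K : NNReal} (_ : LipschitzWith K fun p : Euc d × Euc n => v p.1 p.2),
      ∃ M : ℝ, 0 ≤ M ∧ ∀ z, ∀ a ∈ S, ‖v z a‖ ≤ M * (1 + ‖z‖) := by
    intro n S hS v K hv
    obtain ⟨M, hM⟩ := (hS.image (f := v 0) (hv.continuous.comp
      (by fun_prop : Continuous fun a : Euc n => ((0 : Euc d), a)))).isBounded.exists_norm_le
    refine ⟨max M 0 + K, by positivity, fun z a ha => ?_⟩
    have h1 : ‖v z a - v 0 a‖ ≤ K * ‖z‖ := by
      have := hv.dist_le_mul (z, a) (0, a)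
      simpa [dist_eq_norm, Prod.norm_def] using this
    have h2 : ‖v 0 a‖ ≤ max M 0 := (hM _ ⟨a, ha, rfl⟩).trans (le_max_left _ _)
    have h3 : ‖v z a‖ ≤ ‖v 0 a‖ + ‖v z a - v 0 a‖ := by
      simpa using norm_add_le (v 0 a) (v z a - v 0 a)
    have h4 : 0 ≤ max M 0 * ‖z‖ := by positivity
    nlinarith [K.2, norm_nonneg z]
  obtain ⟨M1, hM1, hg1⟩ := hgrowth hA hf1
  obtain ⟨M2, hM2, hg2⟩ := hgrowth hB hf2
  have hK1 : (K1 : ℝ) ≤ K1 + K2 := le_add_of_nonneg_right K2.2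
  have hK2 : (K2 : ℝ) ≤ K1 + K2 := le_add_of_nonneg_left K1.2
  refine ⟨K1 + K2, M1 + M2, hf1.continuous, hf2.continuous, fun z w a => ?_, fun z w b => ?_,
    fun z b b' => ?_, fun z a ha => (hg1 z a ha).trans ?_, fun z b hb => (hg2 z b hb).trans ?_,
    by positivity, by positivity⟩
  · have := hf1.dist_le_mul (z, a) (w, a)
    refine le_trans ?_ (mul_le_mul_of_nonneg_right hK1 (norm_nonneg _))
    simpa [dist_eq_norm, Prod.norm_def] using this
  · have := hf2.dist_le_mul (z, b) (w, b)
    refine le_trans ?_ (mul_le_mul_of_nonneg_right hK2 (norm_nonneg _))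
    simpa [dist_eq_norm, Prod.norm_def] using this
  · have := hf2.dist_le_mul (z, b) (z, b')
    refine le_trans ?_ (mul_le_mul_of_nonneg_right hK2 (norm_nonneg _))
    simpa [dist_eq_norm, Prod.norm_def] using this
  · gcongr; linarith
  · gcongr; linarith

lemma isCaratheodoryField (hG : IsSeparatedGame A B f1 f2 L c)
    {a : ℝ → A} {b : ℝ → B} (ha : Measurable a) (hb : Measurable b) :
    IsCaratheodoryField (fun z s => f1 z (a s) + f2 z (b s)) (2 * L) (2 * c) where
  measurable := by
    have h1 : Measurable fun p : Euc d × ℝ => (p.1, (a p.2 : Euc nA)) :=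
      measurable_fst.prodMk (measurable_subtype_coe.comp (ha.comp measurable_snd))
    have h2 : Measurable fun p : Euc d × ℝ => (p.1, (b p.2 : Euc nB)) :=
      measurable_fst.prodMk (measurable_subtype_coe.comp (hb.comp measurable_snd))
    exact (hG.cont1.measurable.comp h1).add (hG.cont2.measurable.comp h2)
  lipschitz z w s := by
    rw [add_sub_add_comm]
    linarith [norm_add_le (f1 z (a s) - f1 w (a s)) (f2 z (b s) - f2 w (b s)),
      hG.lip1 z w (a s), hG.lip2 z w (b s)]
  growth z s := by
    linarith [norm_add_le (f1 z (a s)) (f2 z (b s)), hG.growth1 z _ (a s).2,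
      hG.growth2 z _ (b s).2]
  lipschitz_nonneg := mul_nonneg zero_le_two hG.lip_nonneg
  growth_nonneg := mul_nonneg zero_le_two hG.growth_nonneg

lemma intervalIntegrable_left (hG : IsSeparatedGame A B f1 f2 L c)
    {a : ℝ → A} (ha : Measurable a) (z : Euc d) (p q : ℝ) :
    IntervalIntegrable (fun s => f1 z (a s)) volume p q := by
  have hmeas : Measurable fun s => f1 z (a s) :=
    hG.cont1.measurable.comp (measurable_const.prodMk (measurable_subtype_coe.comp ha))
  exact (intervalIntegrable_const (c := c * (1 + ‖z‖))).mono_fun hmeas.aestronglyMeasurable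
    (Filter.Eventually.of_forall fun s => (hG.growth1 z _ (a s).2).trans (le_abs_self _))

lemma intervalIntegrable_right (hG : IsSeparatedGame A B f1 f2 L c)
    {b : ℝ → B} (hb : Measurable b) (z : Euc d) (p q : ℝ) :
    IntervalIntegrable (fun s => f2 z (b s)) volume p q := by
  have hmeas : Measurable fun s => f2 z (b s) :=
    hG.cont2.measurable.comp (measurable_const.prodMk (measurable_subtype_coe.comp hb))
  exact (intervalIntegrable_const (c := c * (1 + ‖z‖))).mono_fun hmeas.aestronglyMeasurable
    (Filter.Eventually.of_forall fun s => (hG.growth2 z _ (b s).2).trans (le_abs_self _))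

variable {τ T : ℝ} {N : ℕ}

lemma norm_oTraj_le (hG : IsSeparatedGame A B f1 f2 L c)
    (hτ : 0 ≤ τ) (hN : N * τ = T) (x : Euc d) (a : ℕ → A) (b : ℕ → B) {k : ℕ}
    (hk : k ≤ N) :
    1 + ‖oTraj (eulerStep f1 f2 τ) x (fun j => (a j : Euc nA))
      (fun j => (b j : Euc nB)) k‖ ≤ Real.exp (2 * c * T) * (1 + ‖x‖) := by
  have hc := hG.growth_nonneg
  set X := oTraj (eulerStep f1 f2 τ) x (fun j => (a j : Euc nA))
      (fun j => (b j : Euc nB)) with hX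
  have h := le_exp_mul_of_le_one_add_mul (w := fun k => 1 + ‖X k‖) (h := 2 * c * τ) (N := N)
    (by positivity) (by positivity) (fun k _ => ?_) hk
  · rwa [show (N : ℝ) * (2 * c * τ) = 2 * c * T by rw [← hN]; ring] at h
  · have h1 : X (k + 1) = X k + τ • (f1 (X k) (a k) + f2 (X k) (b k)) := rfl
    have h2 : ‖τ • (f1 (X k) (a k) + f2 (X k) (b k))‖ ≤ τ * (2 * c * (1 + ‖X k‖)) := by
      rw [norm_smul, Real.norm_of_nonneg hτ]
      refine mul_le_mul_of_nonneg_left ?_ hτ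
      linarith [norm_add_le (f1 (X k) (a k)) (f2 (X k) (b k)), hG.growth1 (X k) _ (a k).2,
        hG.growth2 (X k) _ (b k).2]
    rw [h1]
    linarith [norm_add_le (X k) (τ • (f1 (X k) (a k) + f2 (X k) (b k)))]

lemma norm_oTraj_sub_oTraj_le (hG : IsSeparatedGame A B f1 f2 L c)
    (hτ : 0 ≤ τ) (hN : N * τ = T) (x : Euc d) (a : ℕ → Euc nA)
    {b b' : ℕ → Euc nB} {ε : ℝ} (hε : 0 ≤ ε) (hb : ∀ j, ‖b j - b' j‖ ≤ ε) {k : ℕ} (hk : k ≤ N) :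
    ‖oTraj (eulerStep f1 f2 τ) x a b k -
      oTraj (eulerStep f1 f2 τ) x a b' k‖ ≤
      Real.exp (2 * L * T) * ε := by
  have hL := hG.lip_nonneg
  set X := oTraj (eulerStep f1 f2 τ) x a b with hX
  set X' := oTraj (eulerStep f1 f2 τ) x a b' with hX'
  have h := le_exp_mul_of_le_one_add_mul (w := fun k => ‖X k - X' k‖ + ε) (h := 2 * L * τ)
    (N := N) (by positivity) (by positivity) (fun k _ => ?_) hk
  · rw [show (N : ℝ) * (2 * L * τ) = 2 * L * T by rw [← hN]; ring] at h
    have h0 : X 0 - X' 0 = 0 := sub_self x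
    rw [h0, norm_zero, zero_add] at h
    linarith
  · have h1 : X (k + 1) - X' (k + 1) = (X k - X' k) + τ • ((f1 (X k) (a k) - f1 (X' k) (a k)) +
        (f2 (X k) (b k) - f2 (X' k) (b k)) + (f2 (X' k) (b k) - f2 (X' k) (b' k))) := by
      change (X k + τ • (f1 (X k) (a k) + f2 (X k) (b k))) -
        (X' k + τ • (f1 (X' k) (a k) + f2 (X' k) (b' k))) = _
      module
    have h2 : ‖τ • ((f1 (X k) (a k) - f1 (X' k) (a k)) +
        (f2 (X k) (b k) - f2 (X' k) (b k)) + (f2 (X' k) (b k) - f2 (X' k) (b' k)))‖ ≤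
        τ * (2 * L * ‖X k - X' k‖ + L * ε) := by
      rw [norm_smul, Real.norm_of_nonneg hτ]
      refine mul_le_mul_of_nonneg_left (norm_add₃_le.trans ?_) hτ
      have h3 := mul_le_mul_of_nonneg_left (hb k) hL
      linarith [hG.lip1 (X k) (X' k) (a k), hG.lip2 (X k) (X' k) (b k),
        hG.lip_control (X' k) (b k) (b' k)]
    have h4 : 0 ≤ τ * (L * ε) := by positivity
    rw [h1]
    linarith [norm_add_le (X k - X' k) (τ • ((f1 (X k) (a k) - f1 (X' k) (a k)) +
        (f2 (X k) (b k) - f2 (X' k) (b k)) + (f2 (X' k) (b k) - f2 (X' k) (b' k))))]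

/-- A radius bounding all trajectories on `[0, T]` issued from `x`. -/
def trajBound {d : ℕ} (c T : ℝ) (x : Euc d) : ℝ :=
  2 * Real.exp ((2 * (2 * c) + 1) * T) * (1 + ‖x‖)

lemma trajBound_nonneg (x : Euc d) : 0 ≤ trajBound c T x := by
  unfold trajBound; positivity

lemma norm_oTraj_le_trajBound (hG : IsSeparatedGame A B f1 f2 L c)
    (hτ : 0 ≤ τ) (hN : N * τ = T) (x : Euc d) (a : ℕ → A) (b : ℕ → B)
    {k : ℕ} (hk : k ≤ N) :
    1 + ‖oTraj (eulerStep f1 f2 τ) x (fun j => (a j : Euc nA)) (fun j => (b j : Euc nB)) k‖ ≤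
      trajBound c T x := by
  refine (hG.norm_oTraj_le hτ hN x a b hk).trans ?_
  have hc := hG.growth_nonneg
  have hT : 0 ≤ T := hN ▸ by positivity
  have h1 : Real.exp (2 * c * T) ≤ Real.exp ((2 * (2 * c) + 1) * T) :=
    Real.exp_le_exp.2 (by nlinarith [mul_nonneg hc hT])
  exact mul_le_mul_of_nonneg_right (by linarith [Real.exp_pos (2 * c * T)]) (by positivity)

variable {g φ : Euc d → ℝ} {K : ℝ}

lemma setOf_cPayoff_nonempty (hG : IsSeparatedGame A B f1 f2 L c) (hT : 0 ≤ T) (x : Euc d)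
    {u : ℝ → A} {v : ℝ → B} (hu : Measurable u) (hv : Measurable v) :
    {r : ℝ | ∃ y : ℝ → Euc d, IsSol (fun z a b => f1 z a + f2 z b) T x (fun s => (u s : Euc nA))
      (fun s => (v s : Euc nB)) y ∧ r = cPayoff g φ T y}.Nonempty := by
  obtain ⟨y, hy⟩ := (hG.isCaratheodoryField hu hv).exists_isIntegralSol hT x
  exact ⟨_, y, hy, rfl⟩

lemma abs_sSup_cPayoff_sub_payoff_le (hG : IsSeparatedGame A B f1 f2 L c)
    (hK : 0 ≤ K) (hg : ∀ z w, |g z - g w| ≤ K * ‖z - w‖)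
    (hφ : ∀ z w, |φ z - φ w| ≤ K * ‖z - w‖) (hN0 : 0 < N) (hτ : 0 < τ) (hN : N * τ = T)
    (x : Euc d) {u : ℝ → A} {v : ℝ → B} (hu : Measurable u) (hv : Measurable v)
    {a : ℕ → Euc nA} {b : ℕ → Euc nB} {η : ℝ}
    (hη : ∀ k ≤ N, ‖eulerDefect f1 f2 τ x (fun s => (u s : Euc nA)) (fun s => (v s : Euc nB))
      a b k‖ ≤ η) :
    |sSup {r : ℝ | ∃ y : ℝ → Euc d, IsSol (fun z a b => f1 z a + f2 z b) T x
        (fun s => (u s : Euc nA)) (fun s => (v s : Euc nB)) y ∧ r = cPayoff g φ T y} -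
      payoff g φ N (oTraj (eulerStep f1 f2 τ) x a b)| ≤
      K * (Real.exp (2 * L * T) * (η + 2 * c * trajBound c T x * τ) +
        2 * c * trajBound c T x * τ) := by
  have hT : 0 ≤ T := hN ▸ by positivity
  refine abs_sSup_sub_le (setOf_cPayoff_nonempty hG hT x hu hv) ?_
  rintro _ ⟨y, hy, rfl⟩
  have hF := hG.isCaratheodoryField hu hv
  have hR : ∀ t ∈ Icc 0 T, 1 + ‖y t‖ ≤ trajBound c T x := fun t ht =>
    hF.norm_le_of_isIntegralSol hT hy ht
  have hgrid : ∀ k ≤ N, ‖y (k * τ) - oTraj (eulerStep f1 f2 τ) x a b k‖ ≤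
      Real.exp (2 * L * T) * (η + 2 * c * trajBound c T x * τ) := fun k hk =>
    hF.norm_sub_le_of_defect_le hτ.le hN hy hR (p := fun j =>
      τ • (f1 (oTraj (eulerStep f1 f2 τ) x a b j) (a j) +
        f2 (oTraj (eulerStep f1 f2 τ) x a b j) (b j))) rfl (fun _ _ => rfl) hη hk
  have hρ : 0 ≤ 2 * c * trajBound c T x := mul_nonneg hF.growth_nonneg (trajBound_nonneg x)
  refine abs_cPayoff_sub_payoff_le hK hg hφ hN0 hτ hN (fun k hk s hs => ?_) ?_
  · have hk2 : ((k : ℝ) + 1) * τ ≤ T := by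
      rw [← hN]
      exact mul_le_mul_of_nonneg_right (by exact_mod_cast hk) hτ.le
    have h1 := (hF.norm_sub_le_of_isIntegralSol hy hR (by positivity) hs.1 (hs.2.trans hk2)).2
    have h2 : 2 * c * trajBound c T x * (s - k * τ) ≤ 2 * c * trajBound c T x * τ :=
      mul_le_mul_of_nonneg_left (by linarith [hs.2]) hρ
    linarith [hgrid k hk.le,
      norm_sub_le_norm_sub_add_norm_sub (y s) (y (k * τ)) (oTraj (eulerStep f1 f2 τ) x a b k)]
  · have h1 := hgrid N le_rfl
    rw [hN] at h1
    have : 0 ≤ 2 * c * trajBound c T x * τ := by positivity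
    linarith

lemma abs_le_of_lipschitz {g : Euc d → ℝ} (hK : 0 ≤ K) (hg : ∀ z w, |g z - g w| ≤ K * ‖z - w‖)
    {z : Euc d} {R : ℝ} (hz : 1 + ‖z‖ ≤ R) : |g z| ≤ K * R + |g 0| := by
  have h1 := hg z 0
  rw [sub_zero] at h1
  have h2 : K * ‖z‖ ≤ K * R := mul_le_mul_of_nonneg_left (by linarith) hK
  have h3 : |g z| ≤ |g z - g 0| + |g 0| := by simpa using abs_add_le (g z - g 0) (g 0)
  linarith

lemma abs_sSup_cPayoff_le (hG : IsSeparatedGame A B f1 f2 L c)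
    (hK : 0 ≤ K) (hg : ∀ z w, |g z - g w| ≤ K * ‖z - w‖)
    (hφ : ∀ z w, |φ z - φ w| ≤ K * ‖z - w‖) (hT : 0 < T)
    (x : Euc d) {u : ℝ → A} {v : ℝ → B} (hu : Measurable u) (hv : Measurable v) :
    |sSup {r : ℝ | ∃ y : ℝ → Euc d, IsSol (fun z a b => f1 z a + f2 z b) T x
        (fun s => (u s : Euc nA)) (fun s => (v s : Euc nB)) y ∧ r = cPayoff g φ T y}| ≤
      K * trajBound c T x + |g 0| + |φ 0| := by
  rw [← sub_zero (sSup _)]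
  refine abs_sSup_sub_le (setOf_cPayoff_nonempty hG hT.le x hu hv) ?_
  rintro _ ⟨y, hy, rfl⟩
  have hR : ∀ t ∈ Icc 0 T, 1 + ‖y t‖ ≤ trajBound c T x := fun t ht =>
    (hG.isCaratheodoryField hu hv).norm_le_of_isIntegralSol hT.le hy ht
  rw [sub_zero]
  exact abs_cPayoff_le hT
    (fun s hs => by linarith [abs_le_of_lipschitz hK hg (hR s hs), abs_nonneg (φ 0)])
    (fun s hs => by linarith [abs_le_of_lipschitz hK hφ (hR s hs), abs_nonneg (g 0)])

lemma abs_payoff_oTraj_le (hG : IsSeparatedGame A B f1 f2 L c)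
    (hK : 0 ≤ K) (hg : ∀ z w, |g z - g w| ≤ K * ‖z - w‖)
    (hφ : ∀ z w, |φ z - φ w| ≤ K * ‖z - w‖) (hN0 : 0 < N) (hτ : 0 ≤ τ) (hN : N * τ = T)
    (x : Euc d) (a : ℕ → A) (b : ℕ → B) :
    |payoff g φ N (oTraj (eulerStep f1 f2 τ) x (fun j => (a j : Euc nA))
      (fun j => (b j : Euc nB)))| ≤ K * trajBound c T x + |g 0| + |φ 0| := by
  have hR := fun k hk => hG.norm_oTraj_le_trajBound hτ hN x a b (k := k) hk
  exact abs_payoff_le hN0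
    (fun s hs => by linarith [abs_le_of_lipschitz hK hg (hR s hs), abs_nonneg (φ 0)])
    (fun s hs => by linarith [abs_le_of_lipschitz hK hφ (hR s hs), abs_nonneg (g 0)])

/-- A discrete non-anticipative strategy induces a continuous-time one: the opponent's control is
averaged over each cell and the reply is played with a delay of one cell. -/
lemma exists_delayed_strategy (hG : IsSeparatedGame A B f1 f2 L c)
    (hA : A.Nonempty) (hBne : B.Nonempty) (hBc : IsCompact B)
    (hconv : ∀ z, Convex ℝ (f2 z '' B)) (hτ : 0 < τ) (hN : N * τ = T) (x : Euc d)
    {σ : (ℕ → B) → ℕ → A} (hσ : ∀ k h h', (∀ j ≤ k, h j = h' j) → σ h k = σ h' k) :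
    ∃ α : Cm B → Cm A, NonAntC A B T α ∧ ∀ v : Cm B, ∃ h : ℕ → B, ∀ k ≤ N,
      ‖eulerDefect f1 f2 τ x (fun s => ((α v).1 s : Euc nA)) (fun s => (v.1 s : Euc nB))
        (fun j => (σ h j : Euc nA)) (fun j => (h j : Euc nB)) k‖ ≤
        2 * c * trajBound c T x * (1 + T * L) * τ := by
  have : Nonempty B := hBne.to_subtype
  obtain ⟨a₀⟩ : Nonempty A := hA.to_subtype
  let X : (ℕ → B) → ℕ → Euc d := fun h =>
    oTraj (eulerStep f1 f2 τ) x (fun j => (σ h j : Euc nA)) (fun j => (h j : Euc nB))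
  let Φ : Cm B → ℕ → (ℕ → B) → B := fun v k h =>
    Function.invFun (fun b : B => τ • f2 (X h k) b)
      (∫ s in (k * τ)..((k + 1) * τ), f2 (X h k) (v.1 s))
  have hXcausal : ∀ k h h', (∀ j < k, h j = h' j) → X h k = X h' k := fun k h h' hh =>
    oTraj_congr (fun j hj => by rw [hσ j h h' fun i hi => hh i (hi.trans_lt hj)])
      (fun j hj => by rw [hh j hj])
  have hΦ : ∀ v k h h', (∀ j < k, h j = h' j) → Φ v k h = Φ v k h' := fun v k h h' hh => by
    simp only [Φ, hXcausal k h h' hh]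
  choose H hH using fun v => exists_forall_eq_of_causal (hΦ v)
  let reply : Cm B → ℕ → A := fun v m => Nat.casesOn m a₀ (σ (H v))
  let α : Cm B → Cm A := fun v => ⟨fun s => reply v ⌊s / τ⌋₊,
    measurable_from_nat.comp (Nat.measurable_floor.comp (measurable_id.div_const τ))⟩
  refine ⟨α, ?_, fun v => ⟨H v, fun k hk => ?_⟩⟩
  · intro t ht v v' hvv
    refine ae_restrict_of_forall_mem measurableSet_Icc fun s hs => ?_
    have hfl := (mem_Ico_natFloor_div hτ hs.1).1
    change reply v ⌊s / τ⌋₊ = reply v' ⌊s / τ⌋₊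
    generalize ⌊s / τ⌋₊ = m at hfl
    cases m with
    | zero => rfl
    | succ m =>
      refine hσ m _ _ fun j hj => ?_
      refine eq_of_causal (hΦ v) (hH v) (hH v') (m := m + 1) (fun i hi q => ?_) j (by omega)
      have hi' : ((i : ℝ) + 1) * τ ≤ ((m + 1 : ℕ) : ℝ) * τ :=
        mul_le_mul_of_nonneg_right (by exact_mod_cast hi) hτ.le
      simp only [Φ]
      rw [integral_congr_of_ae_restrict_Icc (f2 (X q i)) hvv (by positivity) (by nlinarith)
        (hi'.trans (hfl.trans hs.2))]
  · have hL := hG.lip_nonneg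
    have hc := hG.growth_nonneg
    set R := trajBound c T x with hRdef
    have hR0 : 0 ≤ R := trajBound_nonneg x
    have hXR : ∀ k ≤ N, 1 + ‖X (H v) k‖ ≤ R := fun k hk =>
      hG.norm_oTraj_le_trajBound hτ.le hN x _ _ hk
    have hcell : ∀ j : ℕ, (∫ s in (j * τ)..((j + 1) * τ),
        (f1 (X (H v) j) ((α v).1 s).1 + f2 (X (H v) j) (v.1 s).1)) -
          τ • (f1 (X (H v) j) (σ (H v) j).1 + f2 (X (H v) j) (H v j).1) =
        τ • f1 (X (H v) j) (reply v j).1 -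
          τ • f1 (X (H v) j) (reply v (j + 1)).1 := by
      intro j
      have hlt : (j : ℝ) * τ < (j + 1) * τ := by nlinarith
      have hlen : ((j : ℝ) + 1) * τ - j * τ = τ := by ring
      have h2 : τ • f2 (X (H v) j) (H v j) =
          ∫ s in (j * τ)..((j + 1) * τ), f2 (X (H v) j) (v.1 s) := by
        obtain ⟨b, hb⟩ := exists_smul_eq_integral hBc (v := f2 (X (H v) j))
          (hG.cont2.comp (by fun_prop : Continuous fun b : Euc nB => (X (H v) j, b)))
          (hconv _) v.2 hlt
        rw [hlen] at hb
        have h3 : τ • f2 (X (H v) j) (Φ v j (H v) : Euc nB) =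
            ∫ s in (j * τ)..((j + 1) * τ), f2 (X (H v) j) (v.1 s) :=
          Function.invFun_eq (f := fun b : B => τ • f2 (X (H v) j) b) ⟨b, hb⟩
        rwa [← hH v j] at h3
      have h1 : ∫ s in (j * τ)..((j + 1) * τ), f1 (X (H v) j) ((α v).1 s).1 =
          τ • f1 (X (H v) j) (reply v j).1 := by
        rw [← hlen, ← intervalIntegral.integral_const, hlen]
        refine intervalIntegral.integral_congr_Ioo_of_le hlt.le fun s hs => ?_
        change f1 (X (H v) j) (reply v ⌊s / τ⌋₊).1 = f1 (X (H v) j) (reply v j).1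
        rw [natFloor_div_eq hτ (Ioo_subset_Ico_self hs)]
      rw [intervalIntegral.integral_add (hG.intervalIntegrable_left (α v).2 _ _ _)
        (hG.intervalIntegrable_right v.2 _ _ _), h1, ← h2, smul_add, add_sub_add_right_eq_sub]
    have hstep : ∀ k < N, ‖X (H v) (k + 1) - X (H v) k‖ ≤ 2 * c * R * τ := by
      intro k hk
      have h1 : X (H v) (k + 1) - X (H v) k =
          τ • (f1 (X (H v) k) (σ (H v) k) + f2 (X (H v) k) (H v k)) :=
        add_sub_cancel_left _ _
      rw [h1, norm_smul, Real.norm_of_nonneg hτ.le, mul_comm]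
      refine mul_le_mul_of_nonneg_right ?_ hτ.le
      linarith [norm_add_le (f1 (X (H v) k) (σ (H v) k)) (f2 (X (H v) k) (H v k)),
        hG.growth1 (X (H v) k) _ (σ (H v) k).2, hG.growth2 (X (H v) k) _ (H v k).2,
        mul_le_mul_of_nonneg_left (hXR k hk.le) hc]
    have hreply : ∀ k ≤ N, ‖τ • f1 (X (H v) k) (reply v k).1‖ ≤ c * R * τ := by
      intro k hk
      rw [norm_smul, Real.norm_of_nonneg hτ.le, mul_comm]
      exact mul_le_mul_of_nonneg_right ((hG.growth1 _ _ (reply v k).2).trans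
        (mul_le_mul_of_nonneg_left (hXR k hk) hc)) hτ.le
    set D := eulerDefect f1 f2 τ x (fun s => ((α v).1 s).1) (fun s => (v.1 s).1)
      (fun j => (σ (H v) j).1) (fun j => (H v j).1)
    have hDsucc : ∀ k, D (k + 1) = D k +
        (τ • f1 (X (H v) k) (reply v k).1 - τ • f1 (X (H v) k) (reply v (k + 1)).1) := by
      intro k
      rw [← hcell k]
      exact Finset.sum_range_succ _ _
    have htel : ∀ k ≤ N, ‖D k + τ • f1 (X (H v) k) (reply v k).1‖ ≤
        c * R * τ + k * (τ * (L * (2 * c * R * τ))) := by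
      intro k
      induction k with
      | zero =>
        intro _
        have h0 : D 0 = 0 := Finset.sum_range_zero _
        simpa [h0] using hreply 0 (Nat.zero_le _)
      | succ k ih =>
        intro hk
        have h1 : D (k + 1) + τ • f1 (X (H v) (k + 1)) (reply v (k + 1)).1 =
            (D k + τ • f1 (X (H v) k) (reply v k).1) +
              τ • (f1 (X (H v) (k + 1)) (reply v (k + 1)).1 -
                f1 (X (H v) k) (reply v (k + 1)).1) := by
          rw [hDsucc k]
          module
        have h2 : ‖τ • (f1 (X (H v) (k + 1)) (reply v (k + 1)).1 -
            f1 (X (H v) k) (reply v (k + 1)).1)‖ ≤ τ * (L * (2 * c * R * τ)) := by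
          rw [norm_smul, Real.norm_of_nonneg hτ.le]
          exact mul_le_mul_of_nonneg_left ((hG.lip1 _ _ _).trans
            (mul_le_mul_of_nonneg_left (hstep k (by omega)) hL)) hτ.le
        rw [h1]
        push_cast
        linarith [norm_add_le (D k + τ • f1 (X (H v) k) (reply v k).1)
          (τ • (f1 (X (H v) (k + 1)) (reply v (k + 1)).1 -
            f1 (X (H v) k) (reply v (k + 1)).1)), ih (by omega)]
    have hkT : (k : ℝ) * τ ≤ T := by
      rw [← hN]
      exact mul_le_mul_of_nonneg_right (by exact_mod_cast hk) hτ.le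
    have h1 : k * (τ * (L * (2 * c * R * τ))) ≤ T * (L * (2 * c * R * τ)) := by
      rw [← mul_assoc]
      exact mul_le_mul_of_nonneg_right hkT (by positivity)
    have h2 : ‖D k‖ ≤ ‖D k + τ • f1 (X (H v) k) (reply v k).1‖ +
        ‖τ • f1 (X (H v) k) (reply v k).1‖ := by
      simpa using norm_sub_le (D k + τ • f1 (X (H v) k) (reply v k).1)
        (τ • f1 (X (H v) k) (reply v k).1)
    linarith [htel k hk, hreply k hk]

/-- A continuous-time non-anticipative strategy induces a discrete one, obtained by averaging over
each cell its reply to piecewise constant controls. -/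
lemma exists_averaged_strategy (hG : IsSeparatedGame A B f1 f2 L c)
    (hAne : A.Nonempty) (hAc : IsCompact A)
    (hconv : ∀ z, Convex ℝ (f1 z '' A)) (hτ : 0 < τ) (hN : N * τ = T) (x : Euc d)
    {α : Cm B → Cm A} (hα : NonAntC A B T α) :
    ∃ σ : (ℕ → B) → ℕ → A,
      (∀ k < N, ∀ h h', (∀ j ≤ k, h j = h' j) → σ h k = σ h' k) ∧
      ∀ h, ∃ v : Cm B, ∀ k,
        eulerDefect f1 f2 τ x (fun s => ((α v).1 s : Euc nA)) (fun s => (v.1 s : Euc nB))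
          (fun j => (σ h j : Euc nA)) (fun j => (h j : Euc nB)) k = 0 := by
  have : Nonempty A := hAne.to_subtype
  let V : (ℕ → B) → Cm B := fun h => ⟨fun s => h ⌊s / τ⌋₊,
    measurable_from_nat.comp (Nat.measurable_floor.comp (measurable_id.div_const τ))⟩
  let X : (ℕ → B) → (ℕ → A) → ℕ → Euc d := fun h q =>
    oTraj (eulerStep f1 f2 τ) x (fun j => (q j : Euc nA)) (fun j => (h j : Euc nB))
  let Φ : (ℕ → B) → ℕ → (ℕ → A) → A := fun h k q =>
    Function.invFun (fun a : A => τ • f1 (X h q k) a)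
      (∫ s in (k * τ)..((k + 1) * τ), f1 (X h q k) ((α (V h)).1 s))
  have hΦ : ∀ h k q q', (∀ j < k, q j = q' j) → Φ h k q = Φ h k q' := fun h k q q' hq => by
    have : X h q k = X h q' k := oTraj_congr (fun j hj => by rw [hq j hj]) (fun _ _ => rfl)
    simp only [Φ, this]
  choose σ hσ using fun h => exists_forall_eq_of_causal (hΦ h)
  refine ⟨σ, fun k hk h h' hh => ?_, fun h => ⟨V h, fun k => ?_⟩⟩
  · have hk2 : ((k : ℝ) + 1) * τ ≤ T := by
      rw [← hN]
      exact mul_le_mul_of_nonneg_right (by exact_mod_cast hk) hτ.le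
    have hV : ∀ᵐ s ∂(volume.restrict (Icc (0 : ℝ) ((k + 1) * τ))), (V h).1 s = (V h').1 s := by
      rw [← restrict_Ico_eq_restrict_Icc]
      refine ae_restrict_of_forall_mem measurableSet_Ico fun s hs => hh _ ?_
      rw [← Nat.lt_add_one_iff, Nat.floor_lt (div_nonneg hs.1 hτ.le), div_lt_iff₀ hτ]
      exact_mod_cast hs.2
    have hresp := hα ((k + 1) * τ) ⟨by positivity, hk2⟩ _ _ hV
    refine eq_of_causal (hΦ h) (hσ h) (hσ h') (m := k + 1) (fun i hi q => ?_) k (by omega)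
    have hi' : ((i : ℝ) + 1) * τ ≤ ((k : ℝ) + 1) * τ :=
      mul_le_mul_of_nonneg_right (by exact_mod_cast hi) hτ.le
    have hX : X h q i = X h' q i :=
      oTraj_congr (fun _ _ => rfl) (fun j hj => by rw [hh j (by omega)])
    simp only [Φ]
    rw [hX, integral_congr_of_ae_restrict_Icc (f1 (X h' q i)) hresp (by positivity)
      (by nlinarith) hi']
  · refine Finset.sum_eq_zero fun j _ => ?_
    change (∫ s in (j * τ)..((j + 1) * τ),
      (f1 (X h (σ h) j) ((α (V h)).1 s) + f2 (X h (σ h) j) ((V h).1 s))) -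
        τ • (f1 (X h (σ h) j) (σ h j) + f2 (X h (σ h) j) (h j)) = 0
    have hlt : (j : ℝ) * τ < (j + 1) * τ := by nlinarith
    have hlen : ((j : ℝ) + 1) * τ - j * τ = τ := by ring
    have h1 : τ • f1 (X h (σ h) j) (σ h j) =
        ∫ s in (j * τ)..((j + 1) * τ), f1 (X h (σ h) j) ((α (V h)).1 s) := by
      obtain ⟨a, ha⟩ := exists_smul_eq_integral hAc (v := f1 (X h (σ h) j))
        (hG.cont1.comp (by fun_prop : Continuous fun a : Euc nA => (X h (σ h) j, a)))
        (hconv _) (α (V h)).2 hlt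
      rw [hlen] at ha
      have h3 : τ • f1 (X h (σ h) j) (Φ h j (σ h) : Euc nA) =
          ∫ s in (j * τ)..((j + 1) * τ), f1 (X h (σ h) j) ((α (V h)).1 s) :=
        Function.invFun_eq (f := fun a : A => τ • f1 (X h (σ h) j) a) ⟨a, ha⟩
      rwa [← hσ h j] at h3
    have h2 : ∫ s in (j * τ)..((j + 1) * τ), f2 (X h (σ h) j) ((V h).1 s) =
        τ • f2 (X h (σ h) j) (h j) := by
      rw [← hlen, ← intervalIntegral.integral_const, hlen]
      refine intervalIntegral.integral_congr_Ioo_of_le hlt.le fun s hs => ?_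
      change f2 (X h (σ h) j) (h ⌊s / τ⌋₊) = f2 (X h (σ h) j) (h j)
      rw [natFloor_div_eq hτ (Ioo_subset_Ico_self hs)]
    rw [intervalIntegral.integral_add (hG.intervalIntegrable_left (α (V h)).2 _ _ _)
      (hG.intervalIntegrable_right (V h).2 _ _ _), ← h1, h2, smul_add, sub_self]

end IsSeparatedGame

end Game

section Comparison

/-- Every point of a separable metric space is measurably approximated, up to `ε`, by a member of
a sequence. -/
lemma exists_measurable_nat_dist_le {α : Type*} [PseudoMetricSpace α] [MeasurableSpace α]
    [OpensMeasurableSpace α] [TopologicalSpace.SeparableSpace α] [Nonempty α] {ε : ℝ}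
    (hε : 0 < ε) : ∃ (p : α → ℕ) (q : ℕ → α), Measurable p ∧ ∀ b, dist b (q (p b)) ≤ ε := by
  classical
  have hp : ∀ b : α, ∃ n, dist b (TopologicalSpace.denseSeq α n) < ε := fun b => by
    exact (TopologicalSpace.denseRange_denseSeq α).exists_dist_lt b hε
  exact ⟨fun b => Nat.find (hp b), TopologicalSpace.denseSeq α,
    measurable_find hp fun k => measurableSet_lt (by fun_prop) measurable_const,
    fun b => (Nat.find_spec (hp b)).le⟩

instance nonempty_Cm {n : ℕ} (S : Set (Euc n)) [h : Nonempty S] : Nonempty (Cm S) :=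
  h.map fun s => ⟨fun _ => s, measurable_const⟩

variable {d nA nB : ℕ} {A : Set (Euc nA)} {B : Set (Euc nB)}
  {f1 : Euc d → Euc nA → Euc d} {f2 : Euc d → Euc nB → Euc d} {L c τ T : ℝ} {N : ℕ}
  {g φ : Euc d → ℝ} {K : ℝ}

namespace IsSeparatedGame

lemma v0c_le_V0_add (hG : IsSeparatedGame A B f1 f2 L c)
    (hAne : A.Nonempty) (hBne : B.Nonempty) (hBc : IsCompact B)
    (hconv2 : ∀ z, Convex ℝ (f2 z '' B)) (hK : 0 ≤ K) (hg : ∀ z w, |g z - g w| ≤ K * ‖z - w‖)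
    (hφ : ∀ z w, |φ z - φ w| ≤ K * ‖z - w‖) (hN0 : 0 < N) (hτ : 0 < τ) (hN : N * τ = T)
    (x : Euc d) :
    v0c A B (fun z a b => f1 z a + f2 z b) g φ T x ≤
      V0 A B (eulerStep f1 f2 τ) g φ hN0 x +
        K * (Real.exp (2 * L * T) * (2 * c * trajBound c T x * (1 + T * L) * τ +
          2 * c * trajBound c T x * τ) + 2 * c * trajBound c T x * τ) := by
  have hT : 0 < T := hN ▸ by positivity
  have : Nonempty A := hAne.to_subtype
  have : Nonempty B := hBne.to_subtype
  obtain ⟨a₀⟩ := ‹Nonempty A›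
  have : Nonempty (SN A B N) := ⟨⟨fun _ _ => a₀, measurable_const, fun _ _ _ _ => rfl⟩⟩
  refine iInf_iSup_le_iInf_iSup_add (M := K * trajBound c T x + |g 0| + |φ 0|)
    (fun α v => hG.abs_sSup_cPayoff_le hK hg hφ hT x (α.1 v).2 v.2)
    (fun α b => hG.abs_payoff_oTraj_le hK hg hφ hN0 hτ.le hN x
      (extp hN0 (α.1 b)) (extp hN0 b)) fun α => ?_
  obtain ⟨γ, hγ, H⟩ := hG.exists_delayed_strategy hAne hBne hBc hconv2 hτ hN x
    (σ := fun h k => α.1 (fun i => h i) ⟨k % N, Nat.mod_lt k hN0⟩) fun k h h' hh =>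
      α.2.2 _ _ _ fun j hj => hh j (le_trans (show (j : ℕ) ≤ k % N from hj) (Nat.mod_le k N))
  refine ⟨⟨γ, hγ⟩, fun v => ?_⟩
  obtain ⟨h, hh⟩ := H v
  refine ⟨fun i => h i, ?_⟩
  have h1 := (abs_le.1 (hG.abs_sSup_cPayoff_sub_payoff_le hK hg hφ hN0 hτ hN x (γ v).2 v.2 hh)).2
  have h2 : J0 (eulerStep f1 f2 τ) g φ hN0 x (fun i => (α.1 (fun i => h i) i : Euc nA))
      (fun i => (h i : Euc nB)) = payoff g φ N (oTraj (eulerStep f1 f2 τ) x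
        (fun j => (α.1 (fun i => h i) ⟨j % N, Nat.mod_lt j hN0⟩ : Euc nA))
        (fun j => (h j : Euc nB))) :=
    payoff_congr fun k hk => oTraj_congr (fun _ _ => rfl) fun j hj => by
      simp only [extp, Nat.mod_eq_of_lt (hj.trans_le hk)]
  change _ ≤ J0 (eulerStep f1 f2 τ) g φ hN0 x (fun i => (α.1 (fun i => h i) i : Euc nA))
      (fun i => (h i : Euc nB)) + _
  rw [h2]
  linarith

lemma V0_le_v0c_add (hG : IsSeparatedGame A B f1 f2 L c)
    (hAne : A.Nonempty) (hAc : IsCompact A) (hBne : B.Nonempty)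
    (hconv1 : ∀ z, Convex ℝ (f1 z '' A)) (hK : 0 ≤ K) (hg : ∀ z w, |g z - g w| ≤ K * ‖z - w‖)
    (hφ : ∀ z w, |φ z - φ w| ≤ K * ‖z - w‖) (hN0 : 0 < N) (hτ : 0 < τ) (hN : N * τ = T)
    (x : Euc d) :
    V0 A B (eulerStep f1 f2 τ) g φ hN0 x ≤
      v0c A B (fun z a b => f1 z a + f2 z b) g φ T x +
        K * (Real.exp (2 * L * T) * (2 * c * trajBound c T x * τ + τ) +
          2 * c * trajBound c T x * τ) := by
  have hT : 0 < T := hN ▸ by positivity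
  have : Nonempty A := hAne.to_subtype
  have : Nonempty B := hBne.to_subtype
  obtain ⟨u₀⟩ := nonempty_Cm A
  have : Nonempty {α : Cm B → Cm A // NonAntC A B T α} :=
    ⟨⟨fun _ => u₀, fun _ _ _ _ _ => Filter.Eventually.of_forall fun _ => rfl⟩⟩
  obtain ⟨p, q, hp, hq⟩ := exists_measurable_nat_dist_le (α := B) hτ
  refine iInf_iSup_le_iInf_iSup_add (M := K * trajBound c T x + |g 0| + |φ 0|)
    (fun α b => hG.abs_payoff_oTraj_le hK hg hφ hN0 hτ.le hN x
      (extp hN0 (α.1 b)) (extp hN0 b))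
    (fun α v => hG.abs_sSup_cPayoff_le hK hg hφ hT x (α.1 v).2 v.2) fun α => ?_
  obtain ⟨σ, hσ, H⟩ := hG.exists_averaged_strategy hAne hAc hconv1 hτ hN x α.2
  let β : (Fin N → B) → ℕ → B := fun b => extp hN0 fun i => q (p (b i))
  have hmeas : Measurable fun (b : Fin N → B) (k : Fin N) => σ (β b) k := by
    have h1 : Measurable fun (b : Fin N → B) (i : Fin N) => p (b i) :=
      measurable_pi_lambda _ fun i => hp.comp (measurable_pi_apply i)
    exact (Measurable.of_discrete (f := fun (m : Fin N → ℕ) (k : Fin N) =>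
      σ (extp hN0 fun i => q (m i)) k)).comp h1
  refine ⟨⟨fun b k => σ (β b) k, hmeas, fun k b b' hb => hσ k k.2 _ _ fun j hj => ?_⟩,
    fun b => ?_⟩
  · have hjN : j % N = j := Nat.mod_eq_of_lt (hj.trans_lt k.2)
    change q (p (b ⟨j % N, _⟩)) = q (p (b' ⟨j % N, _⟩))
    rw [hb _ (show j % N ≤ k by omega)]
  obtain ⟨v, hv⟩ := H (β b)
  refine ⟨v, ?_⟩
  have hc := hG.growth_nonneg
  have h1 := (abs_le.1 (hG.abs_sSup_cPayoff_sub_payoff_le hK hg hφ hN0 hτ hN x (α.1 v).2 v.2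
    (η := 0) fun k _ => by rw [hv k, norm_zero])).1
  have hclose : ∀ j, ‖(extp (γ := B) hN0 b j).1 - (β b j).1‖ ≤ τ := fun j => by
    rw [← dist_eq_norm]
    exact hq _
  have h2 := (abs_le.1 (abs_payoff_sub_payoff_le hK hg hφ hN0 fun k hk =>
    hG.norm_oTraj_sub_oTraj_le hτ.le hN x (fun j => (σ (β b) j : Euc nA))
      hτ.le hclose hk)).2
  have h3 : J0 (eulerStep f1 f2 τ) g φ hN0 x (fun i => (σ (β b) i : Euc nA))
      (fun i => (b i : Euc nB)) = payoff g φ N (oTraj (eulerStep f1 f2 τ) x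
        (fun j => (σ (β b) j : Euc nA)) (fun j => (extp (γ := B) hN0 b j).1)) :=
    payoff_congr fun k hk => oTraj_congr (fun j hj => by
      simp only [extp, Nat.mod_eq_of_lt (hj.trans_le hk)]) fun _ _ => rfl
  change J0 (eulerStep f1 f2 τ) g φ hN0 x (fun i => (σ (β b) i : Euc nA))
      (fun i => (b i : Euc nB)) ≤ _
  rw [h3]
  linarith

end IsSeparatedGame

end Comparison

theorem rate_Ot_semidiscrete {d nA nB : ℕ} (hnA : 1 ≤ nA) (hnB : 1 ≤ nB)
    (A : Set (Euc nA)) (B : Set (Euc nB))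
    (hAne : A.Nonempty) (hAc : IsCompact A) (hBne : B.Nonempty) (hBc : IsCompact B)
    (f : Euc d → Euc nA → Euc nB → Euc d)
    (f1 : Euc d → Euc nA → Euc d) (f2 : Euc d → Euc nB → Euc d)
    (K1 K2 : NNReal)
    (hf1 : LipschitzWith K1 fun p : Euc d × Euc nA => f1 p.1 p.2)
    (hf2 : LipschitzWith K2 fun p : Euc d × Euc nB => f2 p.1 p.2)
    -- separable dependency in the controls
    (hsep : ∀ x a b, f x a b = f1 x a + f2 x b)
    -- convexity of the velocity sets
    (hconv1 : ∀ x : Euc d, Convex ℝ (f1 x '' A))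
    (hconv2 : ∀ x : Euc d, Convex ℝ (f2 x '' B))
    (g φ : Euc d → ℝ) (Kg Kφ : NNReal) (hg : LipschitzWith Kg g) (hφ : LipschitzWith Kφ φ)
    (T : ℝ) (hT : 0 < T) :
    ∃ C : ℝ, 0 ≤ C ∧ ∀ (N : ℕ) (hN : 0 < N) (x : Euc d),
      |v0c A B f g φ T x -
          V0 A B (fun z a b => z + (T / N) • f z a b) g φ hN x| ≤
        C * (1 + ‖x‖) * (T / N) := by
  obtain rfl : f = fun z a b => f1 z a + f2 z b := by
    funext z a b
    exact hsep z a b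
  obtain ⟨L, c, hG⟩ := IsSeparatedGame.exists_of_lipschitzWith hAc hBc hf1 hf2
  have hL := hG.lip_nonneg
  have hc := hG.growth_nonneg
  have hlip : ∀ {ψ : Euc d → ℝ} {Kψ : NNReal}, LipschitzWith Kψ ψ → (Kψ : ℝ) ≤ Kg + Kφ →
      ∀ z w, |ψ z - ψ w| ≤ (Kg + Kφ : ℝ) * ‖z - w‖ := fun hψ hle z w =>
    (by simpa [dist_eq_norm] using hψ.dist_le_mul z w : _ ≤ _).trans
      (mul_le_mul_of_nonneg_right hle (norm_nonneg _))
  have hg' := hlip hg (le_add_of_nonneg_right Kφ.2)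
  have hφ' := hlip hφ (le_add_of_nonneg_left Kg.2)
  have hK : (0 : ℝ) ≤ Kg + Kφ := by positivity
  set K : ℝ := Kg + Kφ
  set R := 2 * Real.exp ((2 * (2 * c) + 1) * T) with hR
  have hR0 : 0 ≤ R := by positivity
  set E := Real.exp (2 * L * T)
  refine ⟨K * (E * (2 * c * R * (2 + T * L) + 1) + 2 * c * R), by positivity, fun N hN x => ?_⟩
  have hN' : (0 : ℝ) < N := by exact_mod_cast hN
  have hτ : 0 < T / N := div_pos hT hN'
  have hNτ : N * (T / N) = T := mul_div_cancel₀ T hN'.ne'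
  have h1 := hG.v0c_le_V0_add hAne hBne hBc hconv2 hK hg' hφ' hN hτ hNτ x
  have h2 := hG.V0_le_v0c_add hAne hAc hBne hconv1 hK hg' hφ' hN hτ hNτ x
  rw [IsSeparatedGame.trajBound, ← hR] at h1 h2
  change |_ - V0 A B (eulerStep f1 f2 (T / N)) g φ hN x| ≤ _
  generalize T / N = τ at *
  have hx := norm_nonneg x
  have e1 : 0 ≤ K * (E * τ) * ‖x‖ := by positivity
  have e2 : 0 ≤ K * (E * τ) := by positivity
  have e3 : 0 ≤ K * (E * (2 * c * R * (1 + T * L) * (1 + ‖x‖) * τ)) := by positivity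
  rw [abs_le]
  constructor
  · linarith
  · linarith

end
end

section
/- The expectation of the pointwise infimum equals the infimum over measurable feedback controls: E[ inf_{a ∈ A} Q(X, a) ] = inf_{a ∈ 𝒜} E[ Q(X, a(X)) ]. Moreover the infimum on the right-hand side is attained by some a* ∈ 𝒜. -/
open MeasureTheory Set

noncomputable section

/-- The infimum of a family of measurable functions depending continuously on a parameter in a
separable compact space is measurable. -/
theorem measurable_ciInf_of_continuous {α T : Type*} [MeasurableSpace α] [TopologicalSpace T]
    [CompactSpace T] [TopologicalSpace.SeparableSpace T] {f : α → T → ℝ}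
    (hf : ∀ t, Measurable fun x => f x t) (hc : ∀ x, Continuous (f x)) :
    Measurable fun x => ⨅ t, f x t := by
  obtain ⟨s, hs, hd⟩ := TopologicalSpace.exists_countable_dense T
  have : Countable s := hs
  have heq : (fun x => ⨅ t, f x t) = fun x => ⨅ t : s, f x t := by
    funext x
    exact (hd.ciInf (hc x) (isCompact_range (hc x)).bddBelow).symm
  rw [heq]
  exact Measurable.iInf fun t => hf t

/-- A measurable selection of minimizers over a compact set of real numbers. -/
theorem exists_measurable_isMinOn_of_real {α : Type*} [MeasurableSpace α] {K : Set ℝ}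
    [CompactSpace K] [Nonempty K] {f : α → K → ℝ}
    (hf : ∀ t, Measurable fun x => f x t) (hc : ∀ x, Continuous (f x)) :
    ∃ s : α → K, Measurable s ∧ ∀ x t, f x (s x) ≤ f x t := by
  have hleast (x : α) : ∃ t : K, IsLeast {t | ∀ u, f x t ≤ f x u} t := by
    refine IsCompact.exists_isLeast (IsClosed.isCompact ?_) ?_
    · simp only [ofPred_forall]
      exact isClosed_iInter fun u => isClosed_le (hc x) continuous_const
    · obtain ⟨t, -, ht⟩ := isCompact_univ.exists_isMinOn univ_nonempty (hc x).continuousOn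
      exact ⟨t, fun u => ht (mem_univ u)⟩
  choose s hs using hleast
  have hsm : Measurable fun x => (s x : ℝ) := by
    refine measurable_of_Iic fun r => ?_
    let L : Set K := {u | (u : ℝ) ≤ r}
    have hL : IsClosed L := isClosed_le continuous_subtype_val continuous_const
    have : CompactSpace L := isCompact_iff_compactSpace.mp hL.isCompact
    rcases isEmpty_or_nonempty L with hE | hE
    · convert MeasurableSet.empty
      ext x
      simpa using fun h : (s x : ℝ) ≤ r => hE.false ⟨s x, h⟩
    have hset : (fun x => (s x : ℝ)) ⁻¹' Iic r = {x | ⨅ u : L, f x u ≤ ⨅ u, f x u} := by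
      ext x
      have hmin : ⨅ u, f x u = f x (s x) :=
        le_antisymm (ciInf_le (isCompact_range (hc x)).bddBelow _) (le_ciInf (hs x).1)
      have hcr : Continuous fun u : L => f x u := (hc x).comp continuous_subtype_val
      rw [mem_preimage, mem_ofPred_eq, hmin]
      constructor
      · intro h
        exact ciInf_le (isCompact_range hcr).bddBelow (⟨s x, h⟩ : L)
      · intro h
        obtain ⟨u, -, hu⟩ := isCompact_univ.exists_isMinOn univ_nonempty hcr.continuousOn
        have hle : f x u ≤ f x (s x) := (le_ciInf fun v => hu (mem_univ v)).trans h
        exact le_trans (Subtype.coe_le_coe.mpr ((hs x).2 fun v => hle.trans ((hs x).1 v))) u.2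
    rw [hset]
    exact measurableSet_le
      (measurable_ciInf_of_continuous (fun u : L => hf u)
        fun x => (hc x).comp continuous_subtype_val)
      (measurable_ciInf_of_continuous hf hc)
  exact ⟨s, hsm.subtype_mk, fun x => (hs x).1⟩

/-- A measurable selection of minimizers over a compact metric parameter space. -/
theorem exists_measurable_isMinOn {α T : Type*} [MeasurableSpace α] [MetricSpace T]
    [CompactSpace T] [Nonempty T] [MeasurableSpace T] [BorelSpace T] {f : α → T → ℝ}
    (hf : ∀ t, Measurable fun x => f x t) (hc : ∀ x, Continuous (f x)) :
    ∃ s : α → T, Measurable s ∧ ∀ x t, f x (s x) ≤ f x t := by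
  obtain ⟨g, hgc, hgs⟩ := exists_nat_bool_continuous_surjective_of_compact T
  have hφc : Continuous (g ∘ cantorSetHomeomorphNatToBool) :=
    hgc.comp cantorSetHomeomorphNatToBool.continuous
  have hφs : Function.Surjective (g ∘ cantorSetHomeomorphNatToBool) :=
    hgs.comp cantorSetHomeomorphNatToBool.surjective
  have : CompactSpace cantorSet := isCompact_iff_compactSpace.mp isCompact_cantorSet
  have : Nonempty cantorSet := cantorSetHomeomorphNatToBool.toEquiv.nonempty
  obtain ⟨s, hsm, hs⟩ := exists_measurable_isMinOn_of_real
    (f := fun x u => f x ((g ∘ cantorSetHomeomorphNatToBool) u)) (fun u => hf _)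
    fun x => (hc x).comp hφc
  refine ⟨_, hφc.measurable.comp hsm, fun x t => ?_⟩
  obtain ⟨u, rfl⟩ := hφs t
  exact hs x u

theorem expectation_inf_eq_inf_feedback {d nA : ℕ} (hnA : 1 ≤ nA)
    (A : Set (Euc nA)) (hAne : A.Nonempty) (hAc : IsCompact A)
    {W : Type*} [MeasurableSpace W] (μ : Measure W) [IsProbabilityMeasure μ]
    (X : W → Euc d) (hX : Measurable X)
    (hXint : Integrable (fun ω => ‖X ω‖) μ)
    (Q : Euc d → A → ℝ)
    (hQm : Measurable fun p : Euc d × A => Q p.1 p.2)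
    (C : ℝ) (hC : 0 ≤ C) (hgrow : ∀ (x : Euc d) (a : A), |Q x a| ≤ C * (1 + ‖x‖))
    (hcont : ∀ᵐ x ∂(μ.map X), Continuous fun a : A => Q x a) :
    (∫ ω, (⨅ a : A, Q (X ω) a) ∂μ) =
        (⨅ a : Am d A, ∫ ω, Q (X ω) (a.1 (X ω)) ∂μ) ∧
      ∃ astar : Am d A,
        (∫ ω, Q (X ω) (astar.1 (X ω)) ∂μ) =
          ⨅ a : Am d A, ∫ ω, Q (X ω) (a.1 (X ω)) ∂μ := by
  have : Nonempty A := hAne.to_subtype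
  have : CompactSpace A := isCompact_iff_compactSpace.mp hAc
  obtain ⟨S, hSsub, hSm, hSnull⟩ := exists_measurable_superset_of_null (ae_iff.mp hcont)
  have hScont (x : Euc d) (hx : x ∉ S) : Continuous (Q x) := by
    by_contra h
    exact hx (hSsub h)
  obtain ⟨s, hsm, hs⟩ := exists_measurable_isMinOn
    (f := fun x a => Sᶜ.indicator (fun y => Q y a) x)
    (fun a => (hQm.comp (measurable_id.prodMk measurable_const)).indicator hSm.compl)
    (fun x => by
      by_cases hx : x ∈ S
      · simpa [hx] using continuous_const
      · simpa [hx] using hScont x hx)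
  have hsmin (x : Euc d) (hx : x ∉ S) (a : A) : Q x (s x) ≤ Q x a := by
    simpa [hx] using hs x a
  have hXS : ∀ᵐ ω ∂μ, X ω ∉ S :=
    ae_of_ae_map hX.aemeasurable (measure_eq_zero_iff_ae_notMem.mp hSnull)
  have hbdd (x : Euc d) : BddBelow (range (Q x)) :=
    ⟨-(C * (1 + ‖x‖)), by rintro _ ⟨a, rfl⟩; exact (abs_le.mp (hgrow x a)).1⟩
  have hdom : Integrable (fun ω => C * (1 + ‖X ω‖)) μ :=
    ((integrable_const 1).add hXint).const_mul C
  have hint (a : Am d A) : Integrable (fun ω => Q (X ω) (a.1 (X ω))) μ :=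
    hdom.mono' (hQm.comp (hX.prodMk (a.2.comp hX))).aestronglyMeasurable
      (ae_of_all _ fun ω => hgrow _ _)
  have hinf : ∫ ω, (⨅ a : A, Q (X ω) a) ∂μ = ∫ ω, Q (X ω) (s (X ω)) ∂μ :=
    integral_congr_ae <| hXS.mono fun ω hω =>
      le_antisymm (ciInf_le (hbdd _) _) (le_ciInf (hsmin _ hω))
  have hleast : IsLeast (range fun a : Am d A => ∫ ω, Q (X ω) (a.1 (X ω)) ∂μ)
      (∫ ω, Q (X ω) (s (X ω)) ∂μ) := by
    refine ⟨⟨⟨s, hsm⟩, rfl⟩, ?_⟩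
    rintro _ ⟨a, rfl⟩
    exact integral_mono_ae (hint ⟨s, hsm⟩) (hint a) (hXS.mono fun ω hω => hsmin _ hω _)
  exact ⟨hinf.trans hleast.csInf_eq.symm, ⟨s, hsm⟩, hleast.csInf_eq.symm⟩

end
end

section
/- Assume in addition that X admits a Lebesgue measurable density ρ supported on the closure of a set Ω ⊂ ℝ^d, with ρ(x) > 0 for a.e. x ∈ Ω and |∂Ω| = 0. Then for ā ∈ 𝒜, ā minimizes a ↦ E[ Q(X, a(X)) ] over 𝒜 if and only if ā(x) ∈ argmin_{a ∈ A} Q(x,a) for almost every x ∈ Ω. -/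
open MeasureTheory Set

noncomputable section

section AlmostEverywhere

variable {α : Type*} [TopologicalSpace α] [MeasurableSpace α]
  {ν : Measure α} {s : Set α}

theorem closure_ae_eq_of_measure_frontier_eq_zero (h : ν (frontier s) = 0) :
    ∀ᵐ x ∂ν, x ∈ closure s ↔ x ∈ s := by
  filter_upwards [measure_eq_zero_iff_ae_notMem.1 h] with x hx
  refine ⟨fun hc => ?_, fun hs => subset_closure hs⟩
  by_contra hs
  exact hx ⟨hc, fun hi => hs (interior_subset hi)⟩

variable [OpensMeasurableSpace α]

theorem nullMeasurableSet_of_measure_frontier_eq_zero (h : ν (frontier s) = 0) :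
    NullMeasurableSet s ν :=
  isClosed_closure.measurableSet.nullMeasurableSet.congr <| by
    filter_upwards [closure_ae_eq_of_measure_frontier_eq_zero h] with x hx
    exact propext hx

/-- A density supported on `closure s` and positive almost everywhere on `s` defines a measure
with the same null sets as the restriction to `s`, when the boundary of `s` is negligible. -/
theorem ae_withDensity_eq_ae_restrict {ρ : α → ℝ} (hρ : Measurable ρ)
    (hsupp : ∀ x ∉ closure s, ρ x = 0) (hpos : ∀ᵐ x ∂(ν.restrict s), 0 < ρ x)
    (h : ν (frontier s) = 0) :
    ae (ν.withDensity fun x => ENNReal.ofReal (ρ x)) = ae (ν.restrict s) := by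
  have hs := nullMeasurableSet_of_measure_frontier_eq_zero h
  have hiff : ∀ᵐ x ∂ν, ENNReal.ofReal (ρ x) ≠ 0 ↔ x ∈ s := by
    filter_upwards [(ae_restrict_iff'₀ hs).1 hpos,
      closure_ae_eq_of_measure_frontier_eq_zero h] with x hx hc
    refine ⟨fun h0 => hc.1 ?_, fun hxs => by simpa using hx hxs⟩
    by_contra hn
    simp [hsupp x hn] at h0
  ext t
  change (∀ᵐ x ∂(ν.withDensity fun x => ENNReal.ofReal (ρ x)), x ∈ t) ↔
    ∀ᵐ x ∂(ν.restrict s), x ∈ t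
  rw [ae_withDensity_iff hρ.ennreal_ofReal, ae_restrict_iff'₀ hs]
  refine Filter.eventually_congr ?_
  filter_upwards [hiff] with x hx
  rw [hx]

end AlmostEverywhere

/-- A measurable selector minimizes the integral of a Carathéodory integrand if and only if it
is pointwise minimal almost everywhere. -/
theorem forall_integral_le_iff_ae_forall_le {α β : Type*} [MeasurableSpace α]
    [TopologicalSpace β] [TopologicalSpace.SeparableSpace β] [MeasurableSpace β]
    {ν : Measure α} {Q : α → β → ℝ} (hQm : Measurable fun p : α × β => Q p.1 p.2)
    (hcont : ∀ᵐ x ∂ν, Continuous (Q x))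
    (hint : ∀ a : α → β, Measurable a → Integrable (fun x => Q x (a x)) ν)
    {f : α → β} (hf : Measurable f) :
    (∀ a : α → β, Measurable a → ∫ x, Q x (f x) ∂ν ≤ ∫ x, Q x (a x) ∂ν) ↔
      ∀ᵐ x ∂ν, ∀ b, Q x (f x) ≤ Q x b := by
  classical
  have hQ : ∀ a : α → β, Measurable a → Measurable fun x => Q x (a x) :=
    fun a ha => hQm.comp (measurable_id.prodMk ha)
  refine ⟨fun hmin => ?_, fun h a ha => integral_mono_ae (hint f hf) (hint a ha) ?_⟩
  · have hconst : ∀ b, ∀ᵐ x ∂ν, Q x (f x) ≤ Q x b := by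
      intro b
      set a : α → β := fun x => if Q x b < Q x (f x) then b else f x with ha_def
      have ha : Measurable a :=
        Measurable.ite (measurableSet_lt (hQ _ measurable_const) (hQ f hf)) measurable_const hf
      have hle : ∀ x, Q x (a x) ≤ Q x (f x) := by
        intro x
        simp only [ha_def]
        split_ifs with hx
        exacts [hx.le, le_rfl]
      have heq : (fun x => Q x (a x)) =ᵐ[ν] fun x => Q x (f x) :=
        (integral_eq_iff_of_ae_le (hint a ha) (hint f hf) (.of_forall hle)).1
          (le_antisymm (integral_mono (hint a ha) (hint f hf) hle) (hmin a ha))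
      filter_upwards [heq] with x hx
      by_contra! hlt
      simp only [ha_def, if_pos hlt] at hx
      exact hlt.ne hx
    obtain ⟨D, hDc, hDd⟩ := TopologicalSpace.exists_countable_dense β
    filter_upwards [hcont, (ae_ball_iff hDc).2 fun b _ => hconst b] with x hc hD b
    exact (isClosed_le continuous_const hc).closure_subset_iff.2 hD (hDd b)
  · filter_upwards [h] with x hx using hx (a x)

theorem minimizer_characterization {d nA : ℕ} (hnA : 1 ≤ nA)
    (A : Set (Euc nA)) (hAne : A.Nonempty) (hAc : IsCompact A)
    {W : Type*} [MeasurableSpace W] (μ : Measure W) [IsProbabilityMeasure μ]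
    (X : W → Euc d) (hX : Measurable X)
    (hXint : Integrable (fun ω => ‖X ω‖) μ)
    (Q : Euc d → A → ℝ)
    (hQm : Measurable fun p : Euc d × A => Q p.1 p.2)
    (C : ℝ) (hC : 0 ≤ C) (hgrow : ∀ (x : Euc d) (a : A), |Q x a| ≤ C * (1 + ‖x‖))
    (hcont : ∀ᵐ x ∂(μ.map X), Continuous fun a : A => Q x a)
    -- (H5): `X` has a density `ρ` supported on `closure Ω₀`, positive a.e. on `Ω₀`,
    -- with negligible boundary.
    (ρ : Euc d → ℝ) (hρm : Measurable ρ) (Ω₀ : Set (Euc d))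
    (hmap : μ.map X = volume.withDensity fun x => ENNReal.ofReal (ρ x))
    (hsupp : ∀ x ∉ closure Ω₀, ρ x = 0)
    (hpos : ∀ᵐ x ∂(volume.restrict Ω₀), 0 < ρ x)
    (hbd : volume (frontier Ω₀) = 0)
    (abar : Am d A) :
    (∀ a : Am d A,
        (∫ ω, Q (X ω) (abar.1 (X ω)) ∂μ) ≤ ∫ ω, Q (X ω) (a.1 (X ω)) ∂μ) ↔
      (∀ᵐ x ∂(volume.restrict Ω₀), ∀ a : A, Q x (abar.1 x) ≤ Q x a) := by
  have hmeas : ∀ a : Euc d → A, Measurable a → Measurable fun x => Q x (a x) :=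
    fun a ha => hQm.comp (measurable_id.prodMk ha)
  have hmapint : ∀ a : Euc d → A, Measurable a →
      ∫ ω, Q (X ω) (a (X ω)) ∂μ = ∫ x, Q x (a x) ∂(μ.map X) := fun a ha =>
    (integral_map hX.aemeasurable (hmeas a ha).aestronglyMeasurable).symm
  have hint : ∀ a : Euc d → A, Measurable a → Integrable (fun x => Q x (a x)) (μ.map X) := by
    intro a ha
    rw [integrable_map_measure (hmeas a ha).aestronglyMeasurable hX.aemeasurable]
    exact (((integrable_const (1 : ℝ)).add hXint).const_mul C).mono'
      ((hmeas a ha).comp hX).aestronglyMeasurable (.of_forall fun ω => hgrow (X ω) (a (X ω)))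
  rw [← ae_withDensity_eq_ae_restrict hρm hsupp hpos hbd, ← hmap,
    ← forall_integral_le_iff_ae_forall_le hQm hcont hint abar.2]
  refine ⟨fun h a ha => ?_, fun h a => ?_⟩
  · rw [← hmapint _ abar.2, ← hmapint a ha]
    exact h ⟨a, ha⟩
  · rw [hmapint _ abar.2, hmapint _ a.2]
    exact h a.1 a.2

end
end

section
/- The expectation of the pointwise inf–sup equals the inf–sup of expectations over measurable feedback controls: E[ inf_{a ∈ A} sup_{b ∈ B} Q(X, a, b) ] = inf_{a ∈ 𝒜} sup_{b ∈ ℬ} E[ Q(X, a(X), b(X)) ], and an optimal a* ∈ 𝒜 attaining the right-hand side infimum exists. -/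
open MeasureTheory Set

noncomputable section

/-- The supremum over a compact space of a Carathéodory function is measurable. -/
theorem measurable_iSup_of_continuous {E K : Type*} [MeasurableSpace E] [TopologicalSpace K]
    [CompactSpace K] [TopologicalSpace.SeparableSpace K] {f : E → K → ℝ}
    (hm : ∀ k, Measurable fun x => f x k) (hc : ∀ x, Continuous (f x)) :
    Measurable fun x => ⨆ k, f x k := by
  obtain ⟨D, hD, hDd⟩ := TopologicalSpace.exists_countable_dense K
  have := hD.to_subtype
  have h : (fun x => ⨆ k, f x k) = fun x => ⨆ k : D, f x k := by
    funext x
    exact (hDd.ciSup (hc x) (isCompact_range (hc x)).bddAbove).symm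
  rw [h]
  exact .iSup fun k => hm k

/-- The infimum over a compact space of a Carathéodory function is measurable. -/
theorem measurable_iInf_of_continuous {E K : Type*} [MeasurableSpace E] [TopologicalSpace K]
    [CompactSpace K] [TopologicalSpace.SeparableSpace K] {f : E → K → ℝ}
    (hm : ∀ k, Measurable fun x => f x k) (hc : ∀ x, Continuous (f x)) :
    Measurable fun x => ⨅ k, f x k := by
  obtain ⟨D, hD, hDd⟩ := TopologicalSpace.exists_countable_dense K
  have := hD.to_subtype
  have h : (fun x => ⨅ k, f x k) = fun x => ⨅ k : D, f x k := by
    funext x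
    exact (hDd.ciInf (hc x) (isCompact_range (hc x)).bddBelow).symm
  rw [h]
  exact .iInf fun k => hm k

/-- On a compact set of reals, the least minimizer of a Carathéodory function is measurable. -/
theorem exists_measurable_argmin_of_isCompact_real {E : Type*} [MeasurableSpace E] {K : Set ℝ}
    (hK : IsCompact K) (hne : K.Nonempty) {f : E → K → ℝ}
    (hm : ∀ k, Measurable fun x => f x k) (hc : ∀ x, Continuous (f x)) :
    ∃ s : E → K, Measurable s ∧ ∀ x k, f x (s x) ≤ f x k := by
  have := hne.to_subtype
  have := isCompact_iff_compactSpace.mp hK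
  have hbdd : ∀ x, BddBelow (range (f x)) := fun x => (isCompact_range (hc x)).bddBelow
  have hleast : ∀ x, ∃ t, IsLeast {t : K | f x t ≤ ⨅ k, f x k} t := by
    intro x
    refine (isClosed_le (hc x) continuous_const).isCompact.exists_isLeast ?_
    obtain ⟨t, -, ht⟩ := isCompact_univ.exists_isMinOn univ_nonempty (hc x).continuousOn
    exact ⟨t, mem_ofPred.mpr (le_ciInf fun k => ht (mem_univ k))⟩
  choose s hs using hleast
  refine ⟨s, ?_, fun x k => (hs x).1.trans (ciInf_le (hbdd x) k)⟩
  have hval : Measurable fun x => (s x : ℝ) := by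
    refine measurable_of_Iic fun c => ?_
    have hT : IsCompact {t : K | (t : ℝ) ≤ c} :=
      (isClosed_le continuous_subtype_val continuous_const).isCompact
    rcases {t : K | (t : ℝ) ≤ c}.eq_empty_or_nonempty with h0 | h0
    · convert MeasurableSet.empty
      refine eq_empty_of_forall_notMem fun x hx => ?_
      exact (h0 ▸ (show s x ∈ {t : K | (t : ℝ) ≤ c} from hx) : s x ∈ (∅ : Set K))
    · have := isCompact_iff_compactSpace.mp hT
      have := h0.to_subtype
      have hset : (fun x => (s x : ℝ)) ⁻¹' Iic c =
          {x | ⨅ t : {t : K | (t : ℝ) ≤ c}, f x t ≤ ⨅ k, f x k} := by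
        ext x
        constructor
        · intro hx
          exact (ciInf_le ((hbdd x).mono (range_comp_subset_range Subtype.val (f x)))
            (⟨s x, hx⟩ : {t : K | (t : ℝ) ≤ c})).trans (hs x).1
        · intro hx
          obtain ⟨t, ht, hmin⟩ := hT.exists_isMinOn h0 (hc x).continuousOn
          have htm : f x t ≤ ⨅ k, f x k := (le_ciInf fun u => hmin u.2).trans hx
          exact (Subtype.coe_le_coe.mpr ((hs x).2 htm)).trans ht
      rw [hset]
      exact measurableSet_le
        (measurable_iInf_of_continuous (fun t => hm t)
          fun x => (hc x).comp continuous_subtype_val)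
        (measurable_iInf_of_continuous hm hc)
  exact hval.subtype_mk (h := fun x => (s x).2)

/-- Measurable selection of a minimizer of a Carathéodory function on a compact metric space. -/
theorem exists_measurable_argmin {E K : Type*} [MeasurableSpace E] [MetricSpace K]
    [CompactSpace K] [Nonempty K] [MeasurableSpace K] [BorelSpace K] {f : E → K → ℝ}
    (hm : ∀ k, Measurable fun x => f x k) (hc : ∀ x, Continuous (f x)) :
    ∃ s : E → K, Measurable s ∧ ∀ x k, f x (s x) ≤ f x k := by
  obtain ⟨g, hg, hgs⟩ := exists_nat_bool_continuous_surjective_of_compact K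
  have hG : Continuous (g ∘ cantorSetHomeomorphNatToBool) :=
    hg.comp cantorSetHomeomorphNatToBool.continuous
  have hGs : Function.Surjective (g ∘ cantorSetHomeomorphNatToBool) :=
    hgs.comp cantorSetHomeomorphNatToBool.surjective
  obtain ⟨s, hs, hmin⟩ := exists_measurable_argmin_of_isCompact_real isCompact_cantorSet
    (nonempty_coe_sort.mp ⟨cantorSetHomeomorphNatToBool.symm fun _ => true⟩)
    (f := fun x t => f x ((g ∘ cantorSetHomeomorphNatToBool) t))
    (fun t => hm _) (fun x => (hc x).comp hG)
  refine ⟨_, hG.measurable.comp hs, fun x k => ?_⟩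
  obtain ⟨t, rfl⟩ := hGs k
  exact hmin x t

/-- Exchange of expectation and inf-sup for an everywhere Carathéodory integrand, with
optimality of a measurable feedback. -/
theorem integral_infsup_eq_of_continuous {E A B W : Type*} [MeasurableSpace E]
    [MetricSpace A] [CompactSpace A] [Nonempty A] [MeasurableSpace A] [BorelSpace A]
    [MetricSpace B] [CompactSpace B] [Nonempty B] [MeasurableSpace B] [BorelSpace B]
    [MeasurableSpace W] (μ : Measure W) {X : W → E} (hX : Measurable X)
    {Q : E → A → B → ℝ} (hQm : Measurable fun p : E × A × B => Q p.1 p.2.1 p.2.2)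
    (hQc : ∀ x, Continuous fun p : A × B => Q x p.1 p.2)
    {G : W → ℝ} (hG : Integrable G μ) (hQG : ∀ w a b, |Q (X w) a b| ≤ G w) :
    ∃ astar : {a : E → A // Measurable a},
      (∫ w, (⨅ a, ⨆ b, Q (X w) a b) ∂μ) =
        (⨆ b : {b : E → B // Measurable b}, ∫ w, Q (X w) (astar.1 (X w)) (b.1 (X w)) ∂μ) ∧
      (⨆ b : {b : E → B // Measurable b}, ∫ w, Q (X w) (astar.1 (X w)) (b.1 (X w)) ∂μ) =
        ⨅ a : {a : E → A // Measurable a}, ⨆ b : {b : E → B // Measurable b},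
          ∫ w, Q (X w) (a.1 (X w)) (b.1 (X w)) ∂μ := by
  have hint : ∀ (a : {a : E → A // Measurable a}) (b : {b : E → B // Measurable b}),
      Integrable (fun w => Q (X w) (a.1 (X w)) (b.1 (X w))) μ := fun a b =>
    hG.mono' ((hQm.comp (measurable_id.prodMk (a.2.prodMk b.2))).comp hX).aestronglyMeasurable
      (.of_forall fun w => hQG w _ _)
  have hcb : ∀ x a, Continuous (Q x a) := fun x a =>
    (hQc x).comp (Continuous.prodMk_right a)
  have hbddb : ∀ x a, BddAbove (range (Q x a)) := fun x a =>
    (isCompact_range (hcb x a)).bddAbove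
  -- the best response to a feedback attains the pointwise supremum
  have hresp : ∀ a : {a : E → A // Measurable a}, ∃ b : {b : E → B // Measurable b},
      ∀ x, Q x (a.1 x) (b.1 x) = ⨆ b', Q x (a.1 x) b' := by
    intro a
    obtain ⟨s, hs, hmax⟩ := exists_measurable_argmin (f := fun x b => -Q x (a.1 x) b)
      (fun b => (hQm.comp (measurable_id.prodMk (a.2.prodMk measurable_const))).neg)
      (fun x => (hcb x _).neg)
    exact ⟨⟨s, hs⟩, fun x => le_antisymm (le_ciSup (hbddb x _) _)
      (ciSup_le fun b => neg_le_neg_iff.mp (hmax x b))⟩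
  have hMint : ∀ a : {a : E → A // Measurable a},
      Integrable (fun w => ⨆ b, Q (X w) (a.1 (X w)) b) μ := by
    intro a
    obtain ⟨b, hb⟩ := hresp a
    simpa only [hb] using hint a b
  have hsup : ∀ a : {a : E → A // Measurable a},
      IsGreatest (range fun b : {b : E → B // Measurable b} =>
        ∫ w, Q (X w) (a.1 (X w)) (b.1 (X w)) ∂μ) (∫ w, ⨆ b, Q (X w) (a.1 (X w)) b ∂μ) := by
    intro a
    constructor
    · obtain ⟨b, hb⟩ := hresp a
      exact ⟨b, by simp only [hb]⟩
    · rintro _ ⟨b, rfl⟩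
      exact integral_mono (hint a b) (hMint a) fun w => le_ciSup (hbddb _ _) _
  have hsup_eq := fun a => (hsup a).csSup_eq
  simp only [sSup_range] at hsup_eq
  obtain ⟨s, hs, hmin⟩ := exists_measurable_argmin (f := fun x a => ⨆ b, Q x a b)
    (fun a => measurable_iSup_of_continuous
      (fun b => hQm.comp (measurable_id.prodMk (measurable_const (a := (a, b))))) fun x => hcb x a)
    (fun x => by
      have h := isCompact_univ.continuous_sSup (f := Q x) (hQc x)
      simpa only [image_univ, sSup_range] using h)
  refine ⟨⟨s, hs⟩, ?_, ?_⟩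
  · rw [hsup_eq]
    refine integral_congr_ae (.of_forall fun w => ?_)
    have h : IsLeast (range fun a => ⨆ b, Q (X w) a b) (⨆ b, Q (X w) (s (X w)) b) :=
      ⟨⟨s (X w), rfl⟩, by rintro _ ⟨a, rfl⟩; exact hmin _ a⟩
    exact h.isGLB.ciInf_eq
  · have h : IsLeast (range fun a : {a : E → A // Measurable a} =>
        ∫ w, ⨆ b, Q (X w) (a.1 (X w)) b ∂μ) (∫ w, ⨆ b, Q (X w) (s (X w)) b ∂μ) := by
      refine ⟨⟨⟨s, hs⟩, rfl⟩, ?_⟩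
      rintro _ ⟨a, rfl⟩
      exact integral_mono (hMint ⟨s, hs⟩) (hMint a) fun w => hmin _ _
    rw [hsup_eq, iInf_congr hsup_eq]
    have : Nonempty {a : E → A // Measurable a} := ⟨⟨s, hs⟩⟩
    exact h.isGLB.ciInf_eq.symm

theorem expectation_infsup_eq_infsup_feedback {d nA nB : ℕ} (hnA : 1 ≤ nA) (hnB : 1 ≤ nB)
    (A : Set (Euc nA)) (hAne : A.Nonempty) (hAc : IsCompact A)
    (B : Set (Euc nB)) (hBne : B.Nonempty) (hBc : IsCompact B)
    {W : Type*} [MeasurableSpace W] (μ : Measure W) [IsProbabilityMeasure μ]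
    (X : W → Euc d) (hX : Measurable X)
    (hXint : Integrable (fun ω => ‖X ω‖) μ)
    (Q : Euc d → A → B → ℝ)
    (hQm : Measurable fun p : Euc d × A × B => Q p.1 p.2.1 p.2.2)
    (C : ℝ) (hC : 0 ≤ C) (hgrow : ∀ (x : Euc d) (a : A) (b : B), |Q x a b| ≤ C * (1 + ‖x‖))
    (hcont : ∀ᵐ x ∂(μ.map X), Continuous fun p : A × B => Q x p.1 p.2) :
    (∫ ω, (⨅ a : A, ⨆ b : B, Q (X ω) a b) ∂μ) =
        (⨅ a : Am d A, ⨆ b : Bm d B, ∫ ω, Q (X ω) (a.1 (X ω)) (b.1 (X ω)) ∂μ) ∧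
      ∃ astar : Am d A,
        (⨆ b : Bm d B, ∫ ω, Q (X ω) (astar.1 (X ω)) (b.1 (X ω)) ∂μ) =
          ⨅ a : Am d A, ⨆ b : Bm d B, ∫ ω, Q (X ω) (a.1 (X ω)) (b.1 (X ω)) ∂μ := by
  classical
  have := hAne.to_subtype
  have := hBne.to_subtype
  have := isCompact_iff_compactSpace.mp hAc
  have := isCompact_iff_compactSpace.mp hBc
  obtain ⟨S, hS, hSm, hSc⟩ := hcont.exists_measurable_mem
  -- modify `Q` on a null set so that it becomes continuous for every state
  let Q' : Euc d → A → B → ℝ := fun x a b => if x ∈ S then Q x a b else 0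
  have hQ'm : Measurable fun p : Euc d × A × B => Q' p.1 p.2.1 p.2.2 :=
    Measurable.ite (measurable_fst hSm) hQm measurable_const
  have hQ'c : ∀ x, Continuous fun p : A × B => Q' x p.1 p.2 := by
    intro x
    by_cases hx : x ∈ S
    · simpa only [Q', hx, if_true] using hSc x hx
    · simpa only [Q', hx, if_false] using continuous_const
  have hQ'G : ∀ w a b, |Q' (X w) a b| ≤ C * (1 + ‖X w‖) := by
    intro w a b
    by_cases hx : X w ∈ S
    · simpa only [Q', hx, if_true] using hgrow (X w) a b
    · simp only [Q', hx, if_false, abs_zero]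
      positivity
  have hQQ' : ∀ᵐ w ∂μ, ∀ a b, Q (X w) a b = Q' (X w) a b := by
    filter_upwards [ae_of_ae_map hX.aemeasurable hS] with w hw a b
    exact (if_pos hw).symm
  obtain ⟨astar, h1, h2⟩ := integral_infsup_eq_of_continuous μ hX hQ'm hQ'c
    (((integrable_const 1).add hXint).const_mul C) hQ'G
  have hI : ∀ (a : Am d A) (b : Bm d B),
      ∫ w, Q (X w) (a.1 (X w)) (b.1 (X w)) ∂μ = ∫ w, Q' (X w) (a.1 (X w)) (b.1 (X w)) ∂μ :=
    fun a b => integral_congr_ae (hQQ'.mono fun w hw => hw _ _)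
  have hJ : ∫ w, (⨅ a : A, ⨆ b : B, Q (X w) a b) ∂μ =
      ∫ w, (⨅ a : A, ⨆ b : B, Q' (X w) a b) ∂μ :=
    integral_congr_ae (hQQ'.mono fun w hw => by simp only [hw])
  simp only [hI, hJ]
  exact ⟨h1.trans h2, astar, h2⟩

end
end

section
/- Assume in addition that X admits a Lebesgue measurable density ρ supported on the closure of a set Ω ⊂ ℝ^d, with ρ(x) > 0 for a.e. x ∈ Ω and |∂Ω| = 0. Then for ā ∈ 𝒜, the following are equivalent: (1) ā minimizes a ↦ sup_{b ∈ ℬ} E[ Q(X, a(X), b(X)) ] over 𝒜 (equivalently, ā minimizes a ↦ E[ max_{b ∈ B} Q(X, a(X), b) ] over 𝒜); (2) ā(x) ∈ argmin_{a ∈ A} max_{b ∈ B} Q(x, a, b) for almost every x ∈ Ω. -/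
open MeasureTheory Set

noncomputable section

lemma bddAbove_range_of_abs_le {Z : Type*} {f : Z → ℝ} {c : ℝ} (h : ∀ y, |f y| ≤ c) :
    BddAbove (range f) :=
  ⟨c, by rintro _ ⟨y, rfl⟩; exact (abs_le.1 (h y)).2⟩

lemma abs_iSup_le {Z : Type*} [Nonempty Z] {f : Z → ℝ} {c : ℝ} (h : ∀ y, |f y| ≤ c) :
    |⨆ y, f y| ≤ c := by
  obtain ⟨y⟩ := ‹Nonempty Z›
  exact abs_le.2 ⟨(abs_le.1 (h y)).1.trans (le_ciSup (bddAbove_range_of_abs_le h) y),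
    ciSup_le fun y => (abs_le.1 (h y)).2⟩

section CaratheodorySelection

variable {E Y : Type*} [MeasurableSpace E]
  [TopologicalSpace Y] [TopologicalSpace.SeparableSpace Y] [Nonempty Y]

/-- A continuous function bounded above has the same supremum along a dense sequence. -/
lemma iSup_denseSeq_eq {f : Y → ℝ} (hf : Continuous f) (hb : BddAbove (range f)) :
    ⨆ n, f (TopologicalSpace.denseSeq Y n) = ⨆ y, f y := by
  have hb' : BddAbove (range fun n => f (TopologicalSpace.denseSeq Y n)) :=
    hb.mono (range_comp_subset_range _ f)
  refine le_antisymm (ciSup_le fun n => le_ciSup hb _) (ciSup_le fun y => ?_)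
  have hcl : IsClosed {y | f y ≤ ⨆ n, f (TopologicalSpace.denseSeq Y n)} :=
    isClosed_le hf continuous_const
  exact (TopologicalSpace.denseRange_denseSeq Y).induction_on y hcl fun n => le_ciSup hb' n

lemma measurable_iSup_of_continuous_s8 {f : E → Y → ℝ} (hm : ∀ y, Measurable fun x => f x y)
    (hc : ∀ x, Continuous (f x)) (hb : ∀ x, BddAbove (range (f x))) :
    Measurable fun x => ⨆ y, f x y := by
  simp_rw [← iSup_denseSeq_eq (hc _) (hb _)]
  exact Measurable.iSup fun n => hm _

lemma exists_measurable_near_iSup [MeasurableSpace Y] {f : E → Y → ℝ}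
    (hm : ∀ y, Measurable fun x => f x y)
    (hc : ∀ x, Continuous (f x)) (hb : ∀ x, BddAbove (range (f x))) {ε : ℝ} (hε : 0 < ε) :
    ∃ s : E → Y, Measurable s ∧ ∀ x, (⨆ y, f x y) - ε < f x (s x) := by
  classical
  have hex : ∀ x, ∃ n, (⨆ y, f x y) - ε < f x (TopologicalSpace.denseSeq Y n) := fun x =>
    exists_lt_of_lt_ciSup (by rw [iSup_denseSeq_eq (hc x) (hb x)]; linarith)
  refine ⟨fun x => TopologicalSpace.denseSeq Y (Nat.find (hex x)), ?_,
    fun x => Nat.find_spec (hex x)⟩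
  exact Measurable.find (f := fun n _ => TopologicalSpace.denseSeq Y n)
    (fun n => measurable_const)
    (fun n => measurableSet_lt ((measurable_iSup_of_continuous_s8 hm hc hb).sub_const ε) (hm _)) hex

/-- Interchange of supremum and integral for a Carathéodory integrand. -/
lemma iSup_integral_eq_integral_iSup [MeasurableSpace Y] {ν : Measure E} [IsProbabilityMeasure ν]
    {f : E → Y → ℝ} (hm : Measurable fun p : E × Y => f p.1 p.2)
    (hc : ∀ x, Continuous (f x)) {g : E → ℝ} (hg : Integrable g ν) (hfg : ∀ x y, |f x y| ≤ g x) :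
    ⨆ b : {b : E → Y // Measurable b}, ∫ x, f x (b.1 x) ∂ν = ∫ x, ⨆ y, f x y ∂ν := by
  have hb : ∀ x, BddAbove (range (f x)) := fun x => bddAbove_range_of_abs_le (hfg x)
  have hm' : ∀ y, Measurable fun x => f x y := fun y => hm.comp measurable_prodMk_right
  have hint : ∀ b : E → Y, Measurable b → Integrable (fun x => f x (b x)) ν := fun b hbm =>
    hg.mono' (hm.comp (measurable_id.prodMk hbm)).aestronglyMeasurable
      (.of_forall fun x => hfg x _)
  have hsup : Integrable (fun x => ⨆ y, f x y) ν :=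
    hg.mono' (measurable_iSup_of_continuous_s8 hm' hc hb).aestronglyMeasurable
      (.of_forall fun x => abs_iSup_le (hfg x))
  have hle : ∀ b : {b : E → Y // Measurable b},
      ∫ x, f x (b.1 x) ∂ν ≤ ∫ x, ⨆ y, f x y ∂ν := fun b =>
    integral_mono (hint b.1 b.2) hsup fun x => le_ciSup (hb x) _
  have : Nonempty {b : E → Y // Measurable b} :=
    ⟨⟨fun _ => Classical.arbitrary Y, measurable_const⟩⟩
  refine le_antisymm (ciSup_le hle) (le_of_forall_pos_le_add fun ε hε => ?_)
  obtain ⟨s, hs, hlt⟩ := exists_measurable_near_iSup hm' hc hb hε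
  calc ∫ x, ⨆ y, f x y ∂ν ≤ ∫ x, (f x (s x) + ε) ∂ν :=
        integral_mono hsup ((hint s hs).add (integrable_const ε)) fun x => by
          linarith [hlt x]
    _ = ∫ x, f x (s x) ∂ν + ε := by
        rw [integral_add (hint s hs) (integrable_const ε)]; simp
    _ ≤ _ := by
        gcongr
        exact le_ciSup (f := fun b : {b : E → Y // Measurable b} => ∫ x, f x (b.1 x) ∂ν)
          ⟨_, by rintro _ ⟨b, rfl⟩; exact hle b⟩ ⟨s, hs⟩

/-- A measurable map minimizes the integral of a Carathéodory integrand if and only if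
it minimizes the integrand almost everywhere. -/
lemma forall_integral_le_iff_ae_forall_le_s8 [MeasurableSpace Y] {ν : Measure E}
    [IsProbabilityMeasure ν]
    {f : E → Y → ℝ} (hm : Measurable fun p : E × Y => f p.1 p.2)
    (hc : ∀ x, Continuous (f x)) {g : E → ℝ} (hg : Integrable g ν) (hfg : ∀ x y, |f x y| ≤ g x)
    {s : E → Y} (hs : Measurable s) :
    (∀ a : {a : E → Y // Measurable a}, ∫ x, f x (s x) ∂ν ≤ ∫ x, f x (a.1 x) ∂ν) ↔
      ∀ᵐ x ∂ν, ∀ y, f x (s x) ≤ f x y := by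
  have hint : ∀ b : E → Y, Measurable b → Integrable (fun x => f x (b x)) ν := fun b hbm =>
    hg.mono' (hm.comp (measurable_id.prodMk hbm)).aestronglyMeasurable
      (.of_forall fun x => hfg x _)
  constructor
  · intro hmin
    have hfg' : ∀ x y, |-f x y| ≤ g x := fun x y => by rw [abs_neg]; exact hfg x y
    have hb : ∀ x, BddAbove (range fun y => -f x y) := fun x => bddAbove_range_of_abs_le (hfg' x)
    have hm' : ∀ y, Measurable fun x => -f x y := fun y => (hm.comp measurable_prodMk_right).neg
    have hc' : ∀ x, Continuous fun y => -f x y := fun x => (hc x).neg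
    have hsup : Integrable (fun x => ⨆ y, -f x y) ν :=
      hg.mono' (measurable_iSup_of_continuous_s8 hm' hc' hb).aestronglyMeasurable
        (.of_forall fun x => abs_iSup_le (hfg' x))
    have hgap0 : ∀ x, 0 ≤ f x (s x) + ⨆ y, -f x y := fun x => by
      have := le_ciSup (hb x) (s x)
      linarith
    have hgap : Integrable (fun x => f x (s x) + ⨆ y, -f x y) ν := (hint s hs).add hsup
    have hzero : ∫ x, (f x (s x) + ⨆ y, -f x y) ∂ν = 0 := by
      refine le_antisymm (le_of_forall_pos_le_add fun ε hε => ?_) (integral_nonneg hgap0)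
      obtain ⟨t, ht, hlt⟩ := exists_measurable_near_iSup hm' hc' hb hε
      have h1 : ∫ x, ⨆ y, -f x y ∂ν ≤ ∫ x, (-f x (t x) + ε) ∂ν :=
        integral_mono hsup ((hint t ht).neg.add (integrable_const ε)) fun x => by
          linarith [hlt x]
      have h2 : ∫ x, (-f x (t x) + ε) ∂ν = -∫ x, f x (t x) ∂ν + ε := by
        rw [integral_add (f := fun x => -f x (t x)) (hint t ht).neg (integrable_const ε),
          integral_neg]
        simp
      rw [integral_add (hint s hs) hsup]
      linarith [hmin ⟨t, ht⟩]
    filter_upwards [(integral_eq_zero_iff_of_nonneg hgap0 hgap).1 hzero] with x hx y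
    have := le_ciSup (hb x) y
    simp only [Pi.zero_apply] at hx this
    linarith
  · intro h a
    refine integral_mono_ae (hint s hs) (hint a.1 a.2) ?_
    filter_upwards [h] with x hx using hx _

end CaratheodorySelection

/-- A density supported on `closure s` and a.e. positive on `s`, where `s` has null frontier,
defines the same null sets as the restriction of the reference measure to `s`. -/
lemma ae_withDensity_iff_ae_restrict {E : Type*} [TopologicalSpace E] [MeasurableSpace E]
    [BorelSpace E] {μ : Measure E} {ρ : E → ℝ} (hρ : Measurable ρ) {s : Set E}
    (hsupp : ∀ x ∉ closure s, ρ x = 0) (hpos : ∀ᵐ x ∂(μ.restrict s), 0 < ρ x)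
    (hbd : μ (frontier s) = 0) {p : E → Prop} :
    (∀ᵐ x ∂(μ.withDensity fun x => ENNReal.ofReal (ρ x)), p x) ↔ ∀ᵐ x ∂(μ.restrict s), p x := by
  have hs : NullMeasurableSet s μ := nullMeasurableSet_of_null_frontier hbd
  rw [ae_restrict_iff'₀ hs] at hpos
  rw [ae_withDensity_iff hρ.ennreal_ofReal, ae_restrict_iff'₀ hs]
  have hcl : ∀ᵐ x ∂μ, x ∈ closure s ↔ x ∈ s := by
    filter_upwards [closure_ae_eq_of_null_frontier hbd] with x hx
    exact Iff.of_eq hx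
  constructor
  · intro h
    filter_upwards [h, hpos] with x hx hx' hxs
    exact hx (by simpa using hx' hxs)
  · intro h
    filter_upwards [h, hcl] with x hx hx' hne
    refine hx (hx'.1 (by_contra fun hn => hne ?_))
    simp [hsupp x hn]

theorem minmax_minimizer_characterization {d nA nB : ℕ} (hnA : 1 ≤ nA) (hnB : 1 ≤ nB)
    (A : Set (Euc nA)) (hAne : A.Nonempty) (hAc : IsCompact A)
    (B : Set (Euc nB)) (hBne : B.Nonempty) (hBc : IsCompact B)
    {W : Type*} [MeasurableSpace W] (μ : Measure W) [IsProbabilityMeasure μ]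
    (X : W → Euc d) (hX : Measurable X)
    (hXint : Integrable (fun ω => ‖X ω‖) μ)
    (Q : Euc d → A → B → ℝ)
    (hQm : Measurable fun p : Euc d × A × B => Q p.1 p.2.1 p.2.2)
    (C : ℝ) (hC : 0 ≤ C) (hgrow : ∀ (x : Euc d) (a : A) (b : B), |Q x a b| ≤ C * (1 + ‖x‖))
    (hcont : ∀ᵐ x ∂(μ.map X), Continuous fun p : A × B => Q x p.1 p.2)
    -- (H5)
    (ρ : Euc d → ℝ) (hρm : Measurable ρ) (Ω₀ : Set (Euc d))
    (hmap : μ.map X = volume.withDensity fun x => ENNReal.ofReal (ρ x))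
    (hsupp : ∀ x ∉ closure Ω₀, ρ x = 0)
    (hpos : ∀ᵐ x ∂(volume.restrict Ω₀), 0 < ρ x)
    (hbd : volume (frontier Ω₀) = 0)
    (abar : Am d A) :
    ((∀ a : Am d A,
        (⨆ b : Bm d B, ∫ ω, Q (X ω) (abar.1 (X ω)) (b.1 (X ω)) ∂μ) ≤
          ⨆ b : Bm d B, ∫ ω, Q (X ω) (a.1 (X ω)) (b.1 (X ω)) ∂μ) ↔
      (∀ᵐ x ∂(volume.restrict Ω₀), ∀ a : A,
        (⨆ b : B, Q x (abar.1 x) b) ≤ ⨆ b : B, Q x a b)) ∧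
    ((∀ a : Am d A,
        (∫ ω, (⨆ b : B, Q (X ω) (abar.1 (X ω)) b) ∂μ) ≤
          ∫ ω, (⨆ b : B, Q (X ω) (a.1 (X ω)) b) ∂μ) ↔
      (∀ᵐ x ∂(volume.restrict Ω₀), ∀ a : A,
        (⨆ b : B, Q x (abar.1 x) b) ≤ ⨆ b : B, Q x a b)) := by
  classical
  have : Nonempty A := hAne.to_subtype
  have : Nonempty B := hBne.to_subtype
  have : CompactSpace B := isCompact_iff_compactSpace.1 hBc
  obtain ⟨T, hT, hTm, hTc⟩ := hcont.exists_measurable_mem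
  set ν : Measure (Euc d) := μ.map X with hν
  have : IsProbabilityMeasure ν := Measure.isProbabilityMeasure_map hX.aemeasurable
  let R : Euc d → A → B → ℝ := fun x a b => if x ∈ T then Q x a b else 0
  have hRm : Measurable fun p : Euc d × A × B => R p.1 p.2.1 p.2.2 :=
    Measurable.ite (measurable_fst hTm) hQm measurable_const
  have hRc : ∀ x, Continuous fun p : A × B => R x p.1 p.2 := fun x => by
    by_cases hx : x ∈ T
    · simpa only [R, if_pos hx] using hTc x hx
    · simpa only [R, if_neg hx] using continuous_const
  have hRg : ∀ x a b, |R x a b| ≤ C * (1 + ‖x‖) := fun x a b => by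
    by_cases hx : x ∈ T
    · simpa only [R, if_pos hx] using hgrow x a b
    · simp only [R, if_neg hx, abs_zero]
      positivity
  have hg : Integrable (fun x : Euc d => C * (1 + ‖x‖)) ν := by
    rw [hν, integrable_map_measure (by fun_prop) hX.aemeasurable]
    exact ((integrable_const 1).add hXint).const_mul C
  have hXT : ∀ᵐ ω ∂μ, X ω ∈ T := ae_of_ae_map hX.aemeasurable hT
  have hRQ : ∀ x ∈ T, ∀ a b, R x a b = Q x a b := fun x hx a b => if_pos hx
  have hSm : Measurable fun p : Euc d × A => ⨆ b, R p.1 p.2 b :=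
    measurable_iSup_of_continuous_s8
      (fun b => hRm.comp (measurable_fst.prodMk (measurable_snd.prodMk measurable_const)))
      (fun p => (hRc p.1).comp (Continuous.prodMk_right p.2))
      fun p => bddAbove_range_of_abs_le (hRg p.1 p.2)
  have hSc : ∀ x, Continuous fun a => ⨆ b, R x a b := fun x => by
    have h := isCompact_univ.continuous_sSup (f := R x) (K := (univ : Set B)) (hRc x)
    simpa only [image_univ, sSup_range] using h
  have hmax : ∀ a : Euc d → A, Measurable a →
      ∫ ω, (⨆ b : B, Q (X ω) (a (X ω)) b) ∂μ = ∫ x, ⨆ b, R x (a x) b ∂ν := fun a ha => by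
    have hm : Measurable fun x => ⨆ b, R x (a x) b := hSm.comp (measurable_id.prodMk ha)
    rw [hν, integral_map hX.aemeasurable hm.aestronglyMeasurable]
    refine integral_congr_ae ?_
    filter_upwards [hXT] with ω hω
    simp only [hRQ _ hω]
  have hsup : ∀ a : Euc d → A, Measurable a →
      (⨆ b : {b : Euc d → B // Measurable b}, ∫ ω, Q (X ω) (a (X ω)) (b.1 (X ω)) ∂μ) =
        ∫ x, ⨆ b, R x (a x) b ∂ν := fun a ha => by
    have hfm : Measurable fun p : Euc d × B => R p.1 (a p.1) p.2 :=
      hRm.comp (measurable_fst.prodMk ((ha.comp measurable_fst).prodMk measurable_snd))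
    rw [← iSup_integral_eq_integral_iSup (f := fun x b => R x (a x) b) hfm
      (fun x => (hRc x).comp (Continuous.prodMk_right (a x))) hg fun x b => hRg x _ b]
    refine iSup_congr fun b => ?_
    have hm : Measurable fun x => R x (a x) (b.1 x) := hfm.comp (measurable_id.prodMk b.2)
    rw [hν, integral_map hX.aemeasurable hm.aestronglyMeasurable]
    refine integral_congr_ae ?_
    filter_upwards [hXT] with ω hω
    exact (hRQ _ hω _ _).symm
  have hkey : (∀ a : Am d A, ∫ x, ⨆ b, R x (abar.1 x) b ∂ν ≤ ∫ x, ⨆ b, R x (a.1 x) b ∂ν) ↔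
      ∀ᵐ x ∂(volume.restrict Ω₀), ∀ a : A, (⨆ b : B, Q x (abar.1 x) b) ≤ ⨆ b : B, Q x a b := by
    rw [← ae_withDensity_iff_ae_restrict hρm hsupp hpos hbd, ← hmap]
    refine (forall_integral_le_iff_ae_forall_le_s8 (f := fun x a => ⨆ b, R x a b) hSm hSc hg
      (fun x a => abs_iSup_le (hRg x a)) abar.2).trans (Filter.eventually_congr ?_)
    filter_upwards [hT] with x hx
    simp only [hRQ x hx]
  exact ⟨(forall_congr' fun a : Am d A => iff_of_eq
      (congrArg₂ (· ≤ ·) (hsup abar.1 abar.2) (hsup a.1 a.2))).trans hkey,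
    (forall_congr' fun a : Am d A => iff_of_eq
      (congrArg₂ (· ≤ ·) (hmax abar.1 abar.2) (hmax a.1 a.2))).trans hkey⟩

end
end
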